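/- arXiv:1109.4863 — 3 statements merged into one kernel-verified Lean document; each statement's English description precedes it below -/
import Mathlib

section
/- If a graph G has no odd components and for every nonempty subset S of V(G) the number of odd components of G−S is at most 2n|S|, then G contains an H_n-factor. -/
open SimpleGraph

/-- `F` is an `Hₙ`-factor of `G`: a spanning subgraph in which every vertex has
degree in `{1, 3, 5, …, 2n-1, 2n}`. -/
def IsHnFactor (n : ℕ) {V : Type*} (G F : SimpleGraph V) : Prop :=
  F ≤ G ∧ ∀ v : V,
    (Odd ((F.neighborSet v).ncard) ∧ (F.neighborSet v).ncard ≤ 2 * n - 1) ∨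
      (F.neighborSet v).ncard = 2 * n

/-- The number of odd components (connected components of odd order) of a graph. -/
noncomputable def oddComponentCount {V : Type*} (G : SimpleGraph V) : ℕ :=
  Nat.card {c : G.ConnectedComponent // Odd (Nat.card c.supp)}

namespace HnFactor

/-- Adjacent vertices outside `S` receive the same colour, so that every colour class outside `S`
is a union of connected components of `G - S`. -/
def Separates {V : Type*} (G : SimpleGraph V) (S : Finset V) (p : V → ℕ) : Prop :=
  ∀ u v, u ∉ S → v ∉ S → G.Adj u v → p u = p v

open Classical in
/-- The total weight of the colour class `i` outside `S`. -/
noncomputable def classWeight {V : Type*} [Fintype V] (f : V → ℕ) (S : Finset V) (p : V → ℕ)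
    (i : ℕ) : ℕ :=
  ∑ v with v ∉ S ∧ p v = i, f v

open Classical in
/-- The colours whose class outside `S` has odd weight. -/
noncomputable def oddColors {V : Type*} [Fintype V] (f : V → ℕ) (S : Finset V) (p : V → ℕ) :
    Finset ℕ :=
  {i ∈ Finset.univ.image p | Odd (classWeight f S p i)}

section Colors

variable {V : Type*} [Fintype V]

lemma classWeight_eq_sum {f : V → ℕ} {S : Finset V} {p : V → ℕ} {i : ℕ} {s : Finset V}
    (hs : ∀ v, v ∈ s ↔ v ∉ S ∧ p v = i) : classWeight f S p i = ∑ v ∈ s, f v := by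
  unfold classWeight
  exact Finset.sum_congr (by ext v; simp [hs]) fun _ _ => rfl

lemma exists_of_odd_classWeight {f : V → ℕ} {S : Finset V} {p : V → ℕ} {i : ℕ}
    (h : Odd (classWeight f S p i)) : ∃ v, v ∉ S ∧ p v = i := by
  classical
  by_contra! hc
  have : classWeight f S p i = 0 := by
    unfold classWeight
    rw [Finset.filter_false_of_mem (fun v _ hv => hc v hv.1 hv.2), Finset.sum_empty]
  simp [this] at h

lemma mem_oddColors {f : V → ℕ} {S : Finset V} {p : V → ℕ} {i : ℕ} :
    i ∈ oddColors f S p ↔ Odd (classWeight f S p i) := by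
  classical
  unfold oddColors
  simp only [Finset.mem_filter, Finset.mem_image, Finset.mem_univ, true_and, and_iff_right_iff_imp]
  intro h
  obtain ⟨v, -, hv⟩ := exists_of_odd_classWeight h
  exact ⟨v, hv⟩

/-- A refinement of a colouring has at least as many odd colours. -/
lemma card_oddColors_le_of_refines {f : V → ℕ} {S : Finset V} {p q : V → ℕ}
    (h : ∀ u v, u ∉ S → v ∉ S → p u = p v → q u = q v) :
    (oddColors f S q).card ≤ (oddColors f S p).card := by
  classical
  have key : ∀ i ∈ oddColors f S q, ∃ j ∈ oddColors f S p, ∃ v, v ∉ S ∧ p v = j ∧ q v = i := by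
    intro i hi
    rw [mem_oddColors] at hi
    have hsum : classWeight f S q i =
        ∑ j ∈ ((Finset.univ.filter fun v => v ∉ S ∧ q v = i).image p), classWeight f S p j := by
      unfold classWeight
      rw [← Finset.sum_fiberwise_of_maps_to (g := p)
        (t := (Finset.univ.filter fun v => v ∉ S ∧ q v = i).image p)
        (fun v hv => Finset.mem_image_of_mem p hv)]
      refine Finset.sum_congr rfl fun j hj => Finset.sum_congr ?_ fun _ _ => rfl
      obtain ⟨w, hw, rfl⟩ := Finset.mem_image.1 hj
      simp only [Finset.mem_filter, Finset.mem_univ, true_and] at hw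
      ext v
      simp only [Finset.mem_filter, Finset.mem_univ, true_and]
      constructor
      · rintro ⟨⟨h1, -⟩, h2⟩
        exact ⟨h1, h2⟩
      · rintro ⟨h1, h2⟩
        exact ⟨⟨h1, (h v w h1 hw.1 h2).trans hw.2⟩, h2⟩
    by_contra! hc
    rw [hsum] at hi
    refine (Nat.not_odd_iff_even.2 (Finset.even_sum _ fun j hj => ?_)) hi
    obtain ⟨w, hw, rfl⟩ := Finset.mem_image.1 hj
    simp only [Finset.mem_filter, Finset.mem_univ, true_and] at hw
    rw [← Nat.not_odd_iff_even, ← mem_oddColors]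
    exact fun hm => hc _ hm w hw.1 rfl hw.2
  choose! g hg v hv using key
  refine Finset.card_le_card_of_injOn g hg fun i hi j hj hij => ?_
  rw [← (hv i hi).2.2, ← (hv j hj).2.2]
  exact h _ _ (hv i hi).1 (hv j hj).1 (by rw [(hv i hi).2.1, (hv j hj).2.1, hij])

/-- The components of `G - S`, presented as a graph `H` embedded in `V`, give the finest colouring
that separates `G` along `S`. -/
lemma exists_finest_coloring {W : Type*} (G : SimpleGraph V) (H : SimpleGraph W) (e : W → V)
    (he : Function.Injective e) (S : Finset V) (hr : ∀ v, v ∉ S ↔ ∃ a, e a = v)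
    (hadj : ∀ a b, H.Adj a b ↔ G.Adj (e a) (e b)) :
    ∃ p : V → ℕ, Separates G S p ∧
      (∀ q, Separates G S q → ∀ u v, u ∉ S → v ∉ S → p u = p v → q u = q v) ∧
      (oddColors (fun _ => 1) S p).card =
        Nat.card {c : H.ConnectedComponent // Odd (Nat.card c.supp)} := by
  classical
  have hW : Finite W := Finite.of_injective e he
  obtain ⟨κ, hκ⟩ := exists_injective_nat H.ConnectedComponent
  obtain ⟨p, hp⟩ : ∃ p : V → ℕ, ∀ a, p (e a) = κ (H.connectedComponentMk a) :=
    ⟨Function.extend e (fun a => κ (H.connectedComponentMk a)) 0, fun a => he.extend_apply _ _ a⟩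
  refine ⟨p, ?_, ?_, ?_⟩
  · intro u v hu hv huv
    obtain ⟨a, rfl⟩ := (hr u).1 hu
    obtain ⟨b, rfl⟩ := (hr v).1 hv
    rw [hp, hp, ConnectedComponent.sound ((hadj a b).2 huv).reachable]
  · intro q hq u v hu hv huv
    obtain ⟨a, rfl⟩ := (hr u).1 hu
    obtain ⟨b, rfl⟩ := (hr v).1 hv
    rw [hp, hp] at huv
    obtain ⟨w⟩ := ConnectedComponent.exact (hκ huv)
    clear huv hu hv
    induction w with
    | nil => rfl
    | cons hab _ ih =>
      exact (hq _ _ ((hr _).2 ⟨_, rfl⟩) ((hr _).2 ⟨_, rfl⟩) ((hadj _ _).1 hab)).trans ih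
  · have hcls : ∀ c : H.ConnectedComponent,
        classWeight (fun _ => 1) S p (κ c) = Nat.card c.supp := by
      intro c
      unfold classWeight
      rw [Nat.card_coe_set_eq, ← Set.ncard_image_of_injective _ he, Finset.sum_const, smul_eq_mul,
        mul_one, ← Set.ncard_coe_finset]
      congr 1
      ext v
      simp only [Finset.coe_filter, Finset.mem_univ, true_and, Set.mem_ofPred_eq, Set.mem_image]
      constructor
      · rintro ⟨h1, h2⟩
        obtain ⟨a, rfl⟩ := (hr v).1 h1
        rw [hp] at h2
        exact ⟨a, hκ h2, rfl⟩
      · rintro ⟨a, ha, rfl⟩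
        refine ⟨(hr _).2 ⟨a, rfl⟩, ?_⟩
        rw [hp]
        exact congrArg κ ha
    have himg : (oddColors (fun _ => 1) S p : Set ℕ) =
        κ '' {c : H.ConnectedComponent | Odd (Nat.card c.supp)} := by
      ext i
      simp only [Finset.mem_coe, mem_oddColors, Set.mem_image, Set.mem_ofPred_eq]
      constructor
      · intro h
        obtain ⟨v, hv, rfl⟩ := exists_of_odd_classWeight h
        obtain ⟨a, rfl⟩ := (hr v).1 hv
        rw [hp] at h ⊢
        rw [hcls] at h
        exact ⟨_, h, rfl⟩
      · rintro ⟨c, hc, rfl⟩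
        rwa [hcls]
    rw [← Set.ncard_coe_finset, himg, Set.ncard_image_of_injective _ hκ, ← Nat.card_coe_set_eq]
    rfl

end Colors

section ParityFactor

variable {V : Type*} [Fintype V]

lemma even_card_of_involution {α : Type*} (s : Finset α) (σ : α → α)
    (hσ : Function.Involutive σ) (hne : ∀ x, σ x ≠ x) (hs : ∀ x ∈ s, σ x ∈ s) : Even s.card := by
  have h : ∑ _x ∈ s, (1 : ZMod 2) = 0 :=
    Finset.sum_involution (fun x _ => σ x) (fun _ _ => by decide) (fun x _ _ => hne x) hs
      (fun x _ => hσ x)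
  rw [Finset.sum_const, nsmul_eq_mul, mul_one] at h
  exact (ZMod.natCast_eq_zero_iff_even).1 h

/-- A fixed-point-free pairing of the copies of the vertices along edges of `G` (or within the
copies of one vertex) gives a spanning subgraph whose degrees are bounded by, and have the parity
of, the numbers of copies. -/
lemma exists_factor_of_involution (G : SimpleGraph V) (f : V → ℕ)
    (σ : (Σ v, Fin (f v)) → Σ v, Fin (f v)) (hσ : Function.Involutive σ) (hne : ∀ x, σ x ≠ x)
    (hadj : ∀ x, x.1 = (σ x).1 ∨ G.Adj x.1 (σ x).1) :
    ∃ F ≤ G, ∀ v, (F.neighborSet v).ncard ≤ f v ∧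
      (Odd (F.neighborSet v).ncard ↔ Odd (f v)) := by
  classical
  let M : V → V → Finset (Σ v, Fin (f v)) := fun u v => {x | x.1 = u ∧ (σ x).1 = v}
  have hM : ∀ u v x, x ∈ M u v ↔ x.1 = u ∧ (σ x).1 = v := fun u v x => by simp [M]
  have hsymm : ∀ u v, (M u v).card = (M v u).card := by
    have hle : ∀ u v, (M u v).card ≤ (M v u).card := fun u v =>
      Finset.card_le_card_of_injOn σ
        (fun x hx => by
          have hx' := (hM _ _ _).1 hx
          exact (hM _ _ _).2 ⟨hx'.2, by rw [hσ x]; exact hx'.1⟩) hσ.injective.injOn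
    exact fun u v => le_antisymm (hle u v) (hle v u)
  have hdiag : ∀ u, Even (M u u).card := fun u =>
    even_card_of_involution _ σ hσ hne fun x hx => by
      have hx' := (hM _ _ _).1 hx
      exact (hM _ _ _).2 ⟨hx'.2, by rw [hσ x]; exact hx'.1⟩
  have htot : ∀ u, ∑ v, (M u v).card = f u := by
    intro u
    have h1 : (Finset.univ.filter fun x : Σ v, Fin (f v) => x.1 = u).card = f u := by
      have : (Finset.univ.filter fun x : Σ v, Fin (f v) => x.1 = u) =
          Finset.univ.map (Function.Embedding.sigmaMk u) := by
        ext ⟨v, i⟩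
        simp only [Finset.mem_filter, Finset.mem_univ, true_and, Finset.mem_map,
          Function.Embedding.sigmaMk_apply]
        constructor
        · rintro rfl
          exact ⟨i, rfl⟩
        · rintro ⟨j, hj⟩
          exact (congrArg Sigma.fst hj).symm
      rw [this, Finset.card_map, Finset.card_univ, Fintype.card_fin]
    rw [← h1, Finset.card_eq_sum_card_fiberwise (f := fun x => (σ x).1) (t := Finset.univ)
      (fun _ _ => Finset.mem_coe.2 (Finset.mem_univ _))]
    refine Finset.sum_congr rfl fun v _ => congrArg Finset.card ?_
    ext x
    simp [M]
  let F : SimpleGraph V :=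
    { Adj := fun u v => u ≠ v ∧ Odd (M u v).card
      symm := ⟨fun u v h => ⟨h.1.symm, hsymm u v ▸ h.2⟩⟩
      loopless := ⟨fun u h => h.1 rfl⟩ }
  refine ⟨F, ?_, fun u => ?_⟩
  · rintro u v ⟨huv, hodd⟩
    obtain ⟨x, hx⟩ := Finset.card_pos.1 hodd.pos
    obtain ⟨rfl, rfl⟩ := (hM _ _ _).1 hx
    exact (hadj x).resolve_left huv
  · have hN : (F.neighborSet u).ncard =
        ((Finset.univ.erase u).filter fun v => Odd (M u v).card).card := by
      rw [← Set.ncard_coe_finset]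
      congr 1
      ext v
      simp [F, eq_comm]
    have hsplit := Finset.add_sum_erase Finset.univ (fun v => (M u v).card) (Finset.mem_univ u)
    simp only [htot] at hsplit
    have hle : ((Finset.univ.erase u).filter fun v => Odd (M u v).card).card ≤
        ∑ v ∈ Finset.univ.erase u, (M u v).card := by
      rw [Finset.card_filter]
      refine Finset.sum_le_sum fun v _ => ?_
      split_ifs with h
      · exact h.pos
      · exact Nat.zero_le _
    have hpar := Finset.odd_sum_iff_odd_card_odd (s := Finset.univ.erase u)
      (fun v => (M u v).card)
    rw [hN]
    refine ⟨by omega, ?_⟩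
    rw [← hpar, ← hsplit, Nat.odd_add']
    simp [hdiag u]

/-- A Tutte-type sufficient condition for a spanning subgraph whose degrees are bounded by `f` and
have the parity of `f`. -/
lemma exists_parity_factor (G : SimpleGraph V) (f : V → ℕ)
    (h : ∀ (X : Finset V) (p : V → ℕ), (∀ v, f v = 0 → v ∈ X) → Separates G X p →
      (oddColors f X p).card ≤ ∑ v ∈ X, f v) :
    ∃ F ≤ G, ∀ v, (F.neighborSet v).ncard ≤ f v ∧
      (Odd (F.neighborSet v).ncard ↔ Odd (f v)) := by
  classical
  let B : SimpleGraph (Σ v, Fin (f v)) :=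
    { Adj := fun x y => x ≠ y ∧ (x.1 = y.1 ∨ G.Adj x.1 y.1)
      symm := ⟨fun x y hxy => ⟨hxy.1.symm, hxy.2.imp Eq.symm SimpleGraph.Adj.symm⟩⟩
      loopless := ⟨fun x hx => hx.1 rfl⟩ }
  suffices hT : ∃ M : Subgraph B, M.IsPerfectMatching by
    obtain ⟨M, hM⟩ := hT
    rw [Subgraph.isPerfectMatching_iff] at hM
    choose σ hσ huniq using hM
    refine exists_factor_of_involution G f σ (fun x => ?_) (fun x => ?_) (fun x => ?_)
    · exact (huniq _ _ (hσ x).symm).symm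
    · exact (M.adj_sub (hσ x)).ne.symm
    · exact (M.adj_sub (hσ x)).2
  rw [tutte]
  intro U hU
  unfold IsTutteViolator at hU
  obtain ⟨T, rfl⟩ : ∃ T : Finset (Σ v, Fin (f v)), (T : Set _) = U := ⟨U.toFinset, by simp⟩
  rw [Set.ncard_coe_finset] at hU
  obtain ⟨p, hp, -, hcard⟩ := exists_finest_coloring B
    ((⊤ : Subgraph B).deleteVerts (T : Set (Σ v, Fin (f v)))).coe Subtype.val
    Subtype.val_injective T (fun v => by simp) (fun a b => by
      have ha := a.2
      have hb := b.2
      simp only [Subgraph.deleteVerts_verts, Set.mem_sdiff] at ha hb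
      simp [ha.2, hb.2])
  have hcount : T.card < (oddColors (fun _ => 1) T p).card := by
    rw [hcard]
    refine hU.trans_eq ?_
    rw [← Nat.card_coe_set_eq]
    rfl
  let X : Finset V := {v | ∀ i : Fin (f v), (⟨v, i⟩ : Σ v, Fin (f v)) ∈ T}
  have hX : ∀ v, v ∉ X → ∃ i : Fin (f v), (⟨v, i⟩ : Σ v, Fin (f v)) ∉ T := fun v hv => by
    simpa [X] using hv
  obtain ⟨q, hq⟩ : ∃ q : V → ℕ, ∀ x : Σ v, Fin (f v), x ∉ T → q x.1 = p x := by
    refine ⟨fun v => if hv : ∃ i : Fin (f v), (⟨v, i⟩ : Σ v, Fin (f v)) ∉ T then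
      p ⟨v, hv.choose⟩ else 0, fun x hx => ?_⟩
    have hv : ∃ i : Fin (f x.1), (⟨x.1, i⟩ : Σ v, Fin (f v)) ∉ T := ⟨x.2, hx⟩
    simp only [dif_pos hv]
    by_cases he : (⟨x.1, hv.choose⟩ : Σ v, Fin (f v)) = x
    · rw [he]
    · exact hp _ _ hv.choose_spec hx ⟨he, Or.inl rfl⟩
  have hqsep : Separates G X q := by
    intro u v hu hv huv
    obtain ⟨i, hi⟩ := hX u hu
    obtain ⟨j, hj⟩ := hX v hv
    rw [hq _ hi, hq _ hj]
    exact hp _ _ hi hj ⟨fun he => huv.ne (congrArg Sigma.fst he), Or.inr huv⟩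
  have hmain := h X q (fun v hv => by
    simp only [X, Finset.mem_filter, Finset.mem_univ, true_and]
    intro i
    exact absurd i.2 (by omega)) hqsep
  let R : Finset (Σ v, Fin (f v)) := T.filter fun x => x.1 ∉ X
  have hTR : T.card = (∑ v ∈ X, f v) + R.card := by
    rw [← Finset.card_filter_add_card_filter_not (s := T) (fun x => x.1 ∈ X)]
    congr 1
    have : (T.filter fun x => x.1 ∈ X) = X.sigma fun v => (Finset.univ : Finset (Fin (f v))) := by
      ext ⟨v, i⟩
      simp only [Finset.mem_filter, Finset.mem_sigma, Finset.mem_univ, and_true,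
        and_iff_right_iff_imp]
      intro hv
      exact (Finset.mem_filter.1 hv).2 i
    rw [this, Finset.card_sigma]
    simp
  have hsub : oddColors (fun _ => 1) T p ⊆ oddColors f X q ∪ R.image fun x => q x.1 := by
    intro j hj
    rw [mem_oddColors] at hj
    rw [Finset.mem_union]
    by_contra! hc
    obtain ⟨hc1, hc2⟩ := hc
    have hR : ∀ x ∈ T, x.1 ∉ X → q x.1 ≠ j := fun x hx hx' hxj =>
      hc2 (Finset.mem_image.2 ⟨x, Finset.mem_filter.2 ⟨hx, hx'⟩, hxj⟩)
    rw [mem_oddColors] at hc1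
    apply hc1
    have : classWeight f X q j = classWeight (fun _ => 1) T p j := by
      rw [classWeight_eq_sum (s := (Finset.univ.filter fun v => v ∉ X ∧ q v = j).sigma
        fun v => (Finset.univ : Finset (Fin (f v)))) fun x => ?_,
        classWeight_eq_sum (s := Finset.univ.filter fun v => v ∉ X ∧ q v = j) fun v => by simp,
        Finset.sum_sigma]
      · simp
      · simp only [Finset.mem_filter, Finset.mem_univ, true_and, Finset.mem_sigma, and_true]
        constructor
        · rintro ⟨h1, h2⟩
          have hxT : x ∉ T := fun hx => hR x hx h1 h2
          exact ⟨hxT, (hq x hxT).symm.trans h2⟩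
        · rintro ⟨h1, h2⟩
          exact ⟨fun hx => h1 ((Finset.mem_filter.1 hx).2 x.2), (hq x h1).trans h2⟩
    rwa [this]
  have := (Finset.card_le_card hsub).trans (Finset.card_union_le _ _)
  have := Finset.card_image_le (s := R) (f := fun x => q x.1)
  omega

end ParityFactor

section Assignment

/-- Hall's theorem with prescribed numbers of partners: every element of `I` is assigned to a
related element of `A` so that each element of `A` receives `m` or `m + 1` elements. -/
lemma exists_assignment {A I : Type*} [Fintype A] [Fintype I] [DecidableEq A] [DecidableEq I]
    (r : A → I → Prop) [∀ a, DecidablePred (r a)] (m : ℕ)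
    (h₁ : ∀ T : Finset A, m * T.card ≤ (T.biUnion fun a => {i | r a i}).card)
    (h₂ : ∀ T : Finset A,
      Fintype.card I ≤ (T.biUnion fun a => {i | r a i}).card + (m + 1) * Tᶜ.card) :
    ∃ φ : I → A, (∀ i, r (φ i) i) ∧
      ∀ a, m ≤ (Finset.univ.filter fun i => φ i = a).card ∧
        (Finset.univ.filter fun i => φ i = a).card ≤ m + 1 := by
  obtain ⟨d, hd⟩ : ∃ d, Fintype.card I + d = (m + 1) * Fintype.card A := by
    have := h₂ ∅
    simp only [Finset.biUnion_empty, Finset.card_empty, zero_add, Finset.compl_empty,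
      Finset.card_univ] at this
    exact Nat.exists_eq_add_of_le this |>.imp fun _ h => h.symm
  let t : A × Fin (m + 1) → Finset (I ⊕ Fin d) := fun x =>
    Finset.disjSum {i | r x.1 i} (if x.2 = Fin.last m then Finset.univ else ∅)
  have hall : ∀ s : Finset (A × Fin (m + 1)), s.card ≤ (s.biUnion t).card := by
    intro s
    let T := s.image Prod.fst
    let N := T.biUnion fun a => (Finset.univ.filter fun i => r a i)
    by_cases hlast : ∃ x ∈ s, x.2 = Fin.last m
    · obtain ⟨x, hx, hxl⟩ := hlast
      have hsub : N.disjSum (Finset.univ : Finset (Fin d)) ⊆ s.biUnion t := by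
        intro y hy
        rw [Finset.mem_biUnion]
        cases y with
        | inl i =>
          simp only [N, T, Finset.inl_mem_disjSum, Finset.mem_biUnion, Finset.mem_image,
            Finset.mem_filter, Finset.mem_univ, true_and] at hy
          obtain ⟨_, ⟨z, hz, rfl⟩, hi⟩ := hy
          exact ⟨z, hz, by simpa [t] using hi⟩
        | inr k => exact ⟨x, hx, by simp [t, hxl]⟩
      have h3 : s.card ≤ (m + 1) * T.card := by
        have : s ⊆ T ×ˢ (Finset.univ : Finset (Fin (m + 1))) := fun z hz =>
          Finset.mem_product.2 ⟨Finset.mem_image_of_mem Prod.fst hz, Finset.mem_univ _⟩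
        have := Finset.card_le_card this
        rw [Finset.card_product, Finset.card_univ, Fintype.card_fin] at this
        linarith
      have h4 := Finset.card_le_card hsub
      rw [Finset.card_disjSum, Finset.card_univ, Fintype.card_fin] at h4
      have h5 := h₂ T
      have h6 := Finset.card_add_card_compl T
      have h7 : N.card = (T.biUnion fun a => (Finset.univ.filter fun i => r a i)).card := rfl
      rw [← h6, mul_add] at hd
      omega
    · push Not at hlast
      have hsub : N.disjSum (∅ : Finset (Fin d)) ⊆ s.biUnion t := by
        intro y hy
        rw [Finset.mem_biUnion]
        cases y with
        | inl i =>
          simp only [N, T, Finset.inl_mem_disjSum, Finset.mem_biUnion, Finset.mem_image,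
            Finset.mem_filter, Finset.mem_univ, true_and] at hy
          obtain ⟨_, ⟨z, hz, rfl⟩, hi⟩ := hy
          exact ⟨z, hz, by simpa [t] using hi⟩
        | inr k => simp at hy
      have h3 : s.card ≤ m * T.card := by
        have : s ⊆ T ×ˢ ((Finset.univ : Finset (Fin (m + 1))).erase (Fin.last m)) := fun z hz => by
          simpa using ⟨Finset.mem_image_of_mem Prod.fst hz, hlast z hz⟩
        have := Finset.card_le_card this
        rw [Finset.card_product, Finset.card_erase_of_mem (Finset.mem_univ _), Finset.card_univ,
          Fintype.card_fin, Nat.add_sub_cancel] at this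
        linarith
      have h4 := Finset.card_le_card hsub
      rw [Finset.card_disjSum, Finset.card_empty] at h4
      exact (h3.trans (h₁ T)).trans h4
  obtain ⟨g, hg, hgt⟩ := (Finset.all_card_le_biUnion_card_iff_exists_injective t).1 hall
  have hbij : Function.Bijective g := by
    rw [Fintype.bijective_iff_injective_and_card]
    refine ⟨hg, ?_⟩
    simp only [Fintype.card_prod, Fintype.card_sum, Fintype.card_fin]
    linarith
  let e := Equiv.ofBijective g hbij
  have he : ∀ x, e x = g x := fun _ => rfl
  refine ⟨fun i => (e.symm (Sum.inl i)).1, fun i => ?_, fun a => ⟨?_, ?_⟩⟩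
  · have := hgt (e.symm (Sum.inl i))
    rw [← he, Equiv.apply_symm_apply] at this
    simpa [t] using this
  · have hinl : ∀ j : Fin m, ∃ i, e (a, j.castSucc) = Sum.inl i := by
      intro j
      have := hgt (a, j.castSucc)
      rw [← he] at this
      rcases hy : e (a, j.castSucc) with i | k
      · exact ⟨i, rfl⟩
      · rw [hy] at this
        simp [t] at this
    choose k hk using hinl
    have := Finset.card_le_card_of_injOn (s := (Finset.univ : Finset (Fin m)))
      (t := Finset.univ.filter fun i => (e.symm (Sum.inl i)).1 = a) k
      (fun j _ => by simp [← hk]) (fun j _ j' _ hjj => by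
        have := (hk j).trans ((congrArg Sum.inl hjj).trans (hk j').symm)
        simpa using this)
    simpa using this
  · have := Finset.card_le_card_of_injOn (t := (Finset.univ : Finset (Fin (m + 1))))
      (s := Finset.univ.filter fun i => (e.symm (Sum.inl i)).1 = a)
      (fun i => (e.symm (Sum.inl i)).2) (fun _ _ => Finset.mem_coe.2 (Finset.mem_univ _))
      (fun i hi i' hi' hii => by
        simp only [Finset.coe_filter, Finset.mem_univ, true_and, Set.mem_ofPred_eq] at hi hi'
        have : e.symm (Sum.inl i) = e.symm (Sum.inl i') := Prod.ext (hi.trans hi'.symm) hii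
        simpa using this)
    simpa using this

end Assignment

open Classical in
/-- Weight `0` on `S`, weight `m - 1` on the chosen vertex `c i` of each class `i ∈ I`, and weight
`m` elsewhere. -/
noncomputable def rootedWeight {V : Type*} (m : ℕ) (S : Finset V) (p : V → ℕ) (I : Finset ℕ) (c : ℕ → V)
    (v : V) : ℕ :=
  if v ∈ S then 0 else if p v ∈ I ∧ c (p v) = v then m - 1 else m

open Classical in
lemma sum_rootedWeight {V : Type*} {m : ℕ} (hm : 1 ≤ m) {S : Finset V} {p : V → ℕ} {I : Finset ℕ}
    {c : ℕ → V} {i : ℕ} {s : Finset V} (hs : ∀ v ∈ s, v ∉ S ∧ p v = i) :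
    ∑ v ∈ s, rootedWeight m S p I c v + (if i ∈ I ∧ c i ∈ s then 1 else 0) = m * s.card := by
  have h1 : ∀ v ∈ s, rootedWeight m S p I c v + (if i ∈ I ∧ c i = v then 1 else 0) = m := by
    intro v hv
    obtain ⟨h1, rfl⟩ := hs v hv
    simp only [rootedWeight, if_neg h1]
    split_ifs <;> omega
  have h2 : ∑ v ∈ s, (if i ∈ I ∧ c i = v then 1 else 0) = if i ∈ I ∧ c i ∈ s then 1 else 0 := by
    by_cases hi : i ∈ I <;> simp [hi]
  rw [← h2, ← Finset.sum_add_distrib, Finset.sum_congr rfl h1, Finset.sum_const, smul_eq_mul,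
    mul_comm]

section Barrier

variable {V : Type*} [Fintype V]

open Classical in
/-- Returning a subset `T` of `S` to the graph destroys only the odd classes adjacent to `T`. -/
lemma exists_separates_sdiff {G : SimpleGraph V} {S : Finset V} {p : V → ℕ}
    (hp : Separates G S p) (T : Finset V) (N : Finset ℕ)
    (hN : ∀ s ∈ T, ∀ v, v ∉ S → G.Adj s v → p v ∈ oddColors (fun _ => 1) S p → p v ∈ N) :
    ∃ q, Separates G (S \ T) q ∧ (oddColors (fun _ => 1) S p).card ≤
      N.card + (oddColors (fun _ => 1) (S \ T) q).card := by
  set I := oddColors (fun _ => 1) S p with hI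
  let q : V → ℕ := fun v => if v ∉ S ∧ p v ∈ I \ N then p v + 1 else 0
  have hkey : ∀ u v, v ∉ S \ T → G.Adj u v → u ∉ S ∧ p u ∈ I \ N → v ∉ S ∧ p v = p u := by
    rintro u v hv huv ⟨hu, hpu⟩
    rw [Finset.mem_sdiff] at hv hpu
    by_cases hvS : v ∈ S
    · have hvT : v ∈ T := by tauto
      exact absurd (hN v hvT u hu huv.symm hpu.1) hpu.2
    · exact ⟨hvS, (hp u v hu hvS huv).symm⟩
  refine ⟨q, ?_, ?_⟩
  · intro u v hu hv huv
    by_cases h1 : u ∉ S ∧ p u ∈ I \ N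
    · obtain ⟨h2, h3⟩ := hkey u v hv huv h1
      have h4 : v ∉ S ∧ p v ∈ I \ N := ⟨h2, h3 ▸ h1.2⟩
      simp only [q, if_pos h1, if_pos h4, h3]
    · by_cases h4 : v ∉ S ∧ p v ∈ I \ N
      · obtain ⟨h2, h3⟩ := hkey v u hu huv.symm h4
        exact absurd ⟨h2, h3 ▸ h4.2⟩ h1
      · simp only [q, if_neg h1, if_neg h4]
  · have hsub : (I \ N).image (· + 1) ⊆ oddColors (fun _ => 1) (S \ T) q := by
      intro j hj
      obtain ⟨i, hi, rfl⟩ := Finset.mem_image.1 hj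
      have hodd := mem_oddColors.1 (Finset.mem_sdiff.1 hi).1
      rw [mem_oddColors]
      have : classWeight (fun _ => 1) (S \ T) q (i + 1) = classWeight (fun _ => 1) S p i := by
        refine classWeight_eq_sum fun v => ?_
        simp only [Finset.mem_filter, Finset.mem_univ, true_and, q]
        constructor
        · rintro ⟨h1, rfl⟩
          exact ⟨fun h => h1 (Finset.mem_sdiff.1 h).1, if_pos ⟨h1, hi⟩⟩
        · rintro ⟨-, h2⟩
          split_ifs at h2 with h
          exact ⟨h.1, by omega⟩
      rwa [this]
    have h1 := Finset.card_le_card hsub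
    rw [Finset.card_image_of_injective _ (add_left_injective 1)] at h1
    have h2 := Finset.card_le_card_sdiff_add_card (s := I) (t := N)
    omega

open Classical in
/-- Refining the class `i` of a colouring along `S` by a colouring along `X`. -/
lemma exists_separates_union {G : SimpleGraph V} {S X : Finset V} {p r : V → ℕ} (π : ℕ → ℕ)
    (hSX : S ⊆ X) (hp : Separates G S p) (hr : Separates G X r) (hπ : ∀ v, π (r v) = p v)
    (i : ℕ) :
    ∃ t, Separates G (S ∪ {v ∈ X \ S | p v = i}) t ∧
      (∀ u v, p u = i → p v = i → t u = t v → r u = r v) ∧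
      {j ∈ oddColors (fun _ => 1) X r | π j = i}.card +
          ((oddColors (fun _ => 1) S p).erase i).card ≤
        (oddColors (fun _ => 1) (S ∪ {v ∈ X \ S | p v = i}) t).card := by
  have hY : ∀ v, v ∉ S ∪ {v ∈ X \ S | p v = i} ↔ v ∉ S ∧ (p v = i → v ∉ X) := by
    intro v
    simp only [Finset.mem_union, Finset.mem_filter, Finset.mem_sdiff]
    tauto
  let t : V → ℕ := fun v => if p v = i then 2 * r v else 2 * p v + 1
  refine ⟨t, ?_, ?_, ?_⟩
  · intro u v hu hv huv
    rw [hY] at hu hv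
    have h1 := hp u v hu.1 hv.1 huv
    by_cases h : p v = i
    · simp only [t, h1, h, if_true, hr u v (hu.2 (h1.trans h)) (hv.2 h) huv]
    · simp only [t, h1, h, if_false]
  · intro u v hu hv h
    simpa [t, hu, hv] using h
  · have hsub : {j ∈ oddColors (fun _ => 1) X r | π j = i}.image (2 * ·) ∪
        ((oddColors (fun _ => 1) S p).erase i).image (2 * · + 1) ⊆
        oddColors (fun _ => 1) (S ∪ {v ∈ X \ S | p v = i}) t := by
      intro k hk
      rw [mem_oddColors]
      rcases Finset.mem_union.1 hk with hk | hk
      · obtain ⟨j, hj, rfl⟩ := Finset.mem_image.1 hk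
        obtain ⟨hj, hji⟩ := Finset.mem_filter.1 hj
        rw [mem_oddColors] at hj
        have : classWeight (fun _ => 1) (S ∪ {v ∈ X \ S | p v = i}) t (2 * j) =
            classWeight (fun _ => 1) X r j := by
          refine classWeight_eq_sum fun v => ?_
          rw [hY]
          simp only [Finset.mem_filter, Finset.mem_univ, true_and, t]
          constructor
          · rintro ⟨h1, rfl⟩
            have h2 : p v = i := by rw [← hπ, hji]
            exact ⟨⟨fun h => h1 (hSX h), fun _ => h1⟩, if_pos h2⟩
          · rintro ⟨⟨-, h1⟩, h2⟩
            split_ifs at h2 with h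
            · exact ⟨h1 h, by omega⟩
            · omega
        rwa [this]
      · obtain ⟨j, hj, rfl⟩ := Finset.mem_image.1 hk
        obtain ⟨hji, hj⟩ := Finset.mem_erase.1 hj
        rw [mem_oddColors] at hj
        have : classWeight (fun _ => 1) (S ∪ {v ∈ X \ S | p v = i}) t (2 * j + 1) =
            classWeight (fun _ => 1) S p j := by
          refine classWeight_eq_sum fun v => ?_
          rw [hY]
          simp only [Finset.mem_filter, Finset.mem_univ, true_and, t]
          constructor
          · rintro ⟨h1, rfl⟩
            exact ⟨⟨h1, fun h => absurd h hji⟩, if_neg hji⟩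
          · rintro ⟨⟨h1, -⟩, h2⟩
            split_ifs at h2 with h
            · omega
            · exact ⟨h1, by omega⟩
        rwa [this]
    refine le_trans (le_of_eq ?_) (Finset.card_le_card hsub)
    rw [Finset.card_union_of_disjoint, Finset.card_image_of_injective _ fun a b h => ?_,
      Finset.card_image_of_injective _ fun a b h => ?_]
    · omega
    · omega
    · rw [Finset.disjoint_left]
      intro k hk hk'
      obtain ⟨a, -, rfl⟩ := Finset.mem_image.1 hk
      obtain ⟨b, -, hb⟩ := Finset.mem_image.1 hk'
      omega

/-- The number of odd classes inside a union of classes has the parity of its order. -/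
lemma odd_card_oddColors_filter {X : Finset V} {r : V → ℕ} (P : ℕ → Prop) [DecidablePred P]
    (C : Finset V) (hC : ∀ v, v ∈ C ↔ v ∉ X ∧ P (r v)) :
    Odd {j ∈ oddColors (fun _ => 1) X r | P j}.card ↔ Odd C.card := by
  classical
  rw [Finset.card_eq_sum_card_image r C, Finset.odd_sum_iff_odd_card_odd]
  have hw : ∀ j, P j → classWeight (fun _ => 1) X r j = (C.filter fun v => r v = j).card := by
    intro j hj
    rw [classWeight_eq_sum (s := C.filter fun v => r v = j) fun v => ?_, Finset.sum_const,
      smul_eq_mul, mul_one]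
    rw [Finset.mem_filter, hC]
    constructor
    · exact fun h => ⟨h.1.1, h.2⟩
    · exact fun h => ⟨⟨h.1, h.2 ▸ hj⟩, h.2⟩
  suffices h : {j ∈ oddColors (fun _ => 1) X r | P j} =
      {j ∈ C.image r | Odd (C.filter fun v => r v = j).card} by rw [h]
  ext j
  simp only [Finset.mem_filter, mem_oddColors, Finset.mem_image]
  constructor
  · rintro ⟨h1, h2⟩
    obtain ⟨v, hv, rfl⟩ := exists_of_odd_classWeight h1
    exact ⟨⟨v, (hC v).2 ⟨hv, h2⟩, rfl⟩, hw _ h2 ▸ h1⟩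
  · rintro ⟨⟨v, hv, rfl⟩, h2⟩
    have h3 := ((hC v).1 hv).2
    exact ⟨(hw _ h3).symm ▸ h2, h3⟩

open Classical in
/-- At a maximal set `S` maximizing the deficiency, the rooted weight satisfies the Tutte-type
condition inside every class. -/
lemma card_filter_oddColors_le {G : SimpleGraph V} {m : ℕ} (hm : Odd m) {S X : Finset V}
    {p r : V → ℕ} {c : ℕ → V} (π : ℕ → ℕ) (hSX : S ⊆ X) (hp : Separates G S p)
    (hfin : ∀ q, Separates G S q → ∀ u v, u ∉ S → v ∉ S → p u = p v → q u = q v)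
    (hmax : ∀ T t, S ⊂ T → Separates G T t → (oddColors (fun _ => 1) T t).card + m * S.card <
      (oddColors (fun _ => 1) S p).card + m * T.card)
    (hc : ∀ i ∈ oddColors (fun _ => 1) S p, c i ∉ S ∧ p (c i) = i)
    (hr : Separates G X r) (hπ : ∀ v, π (r v) = p v) (i : ℕ) :
    {j ∈ oddColors (rootedWeight m S p (oddColors (fun _ => 1) S p) c) X r | π j = i}.card ≤
      ∑ v ∈ X \ S with p v = i, rootedWeight m S p (oddColors (fun _ => 1) S p) c v := by
  obtain ⟨t, ht, htr, hcard⟩ := exists_separates_union π hSX hp hr hπ i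
  have hm1 : 1 ≤ m := hm.pos
  set I := oddColors (fun _ => 1) S p with hI
  set f := rootedWeight m S p I c with hf
  set Y : Finset V := {v ∈ X \ S | p v = i} with hY
  have hYmem : ∀ v, v ∈ Y ↔ (v ∈ X ∧ v ∉ S) ∧ p v = i := by simp [hY]
  have hYsum : ∑ v ∈ Y, f v + (if i ∈ I ∧ c i ∈ Y then 1 else 0) = m * Y.card :=
    sum_rootedWeight (I := I) (c := c) hm1 (s := Y) (S := S) (p := p) (i := i)
    fun v hv => ⟨((hYmem v).1 hv).1.2, ((hYmem v).1 hv).2⟩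
  have hfull : Odd (Finset.univ.filter fun v => v ∉ S ∧ p v = i).card ↔ i ∈ I := by
    rw [hI, mem_oddColors, classWeight_eq_sum (s := Finset.univ.filter fun v => v ∉ S ∧ p v = i)
      fun v => by simp]
    simp
  rcases Y.eq_empty_or_nonempty with hYe | hYne
  · rw [hYe, Finset.sum_empty, Nat.le_zero, Finset.card_eq_zero, Finset.filter_eq_empty_iff]
    intro j hj hji
    rw [hYe, Finset.union_empty] at ht
    rw [mem_oddColors] at hj
    obtain ⟨v, hv, rfl⟩ := exists_of_odd_classWeight hj
    rw [hπ] at hji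
    have hX : ∀ u, u ∉ S → p u = i → u ∉ X := fun u h1 h2 h3 => by
      have : u ∈ Y := (hYmem u).2 ⟨⟨h3, h1⟩, h2⟩
      simp [hYe] at this
    rw [classWeight_eq_sum (s := Finset.univ.filter fun v => v ∉ S ∧ p v = i) fun u => ?_] at hj
    · have h1 := sum_rootedWeight (I := I) (c := c) hm1 (S := S) (p := p) (i := i)
        (s := Finset.univ.filter fun v => v ∉ S ∧ p v = i) fun v hv => by simpa using hv
      by_cases hi : i ∈ I
      · rw [if_pos ⟨hi, by simpa using hc i hi⟩] at h1
        have h2 := hm.mul (hfull.2 hi)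
        rw [← h1] at h2
        exact (Nat.not_odd_iff_even.2 hj.add_one) h2
      · rw [if_neg (fun h => hi h.1), add_zero] at h1
        rw [h1, Nat.odd_mul, hfull] at hj
        exact hi hj.2
    · simp only [Finset.mem_filter, Finset.mem_univ, true_and]
      constructor
      · rintro ⟨h1, h2⟩
        exact ⟨hX u h1 h2, htr u v h2 hji
          (hfin t ht u v h1 (fun h => hv (hSX h)) (h2.trans hji.symm))⟩
      · rintro ⟨h1, h2⟩
        exact ⟨fun h => h1 (hSX h), by rw [← hπ, h2, hπ, hji]⟩
  · have hdisj : Disjoint S Y := Finset.disjoint_left.2 fun v h1 h2 => ((hYmem v).1 h2).1.2 h1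
    have hlt := hmax (S ∪ Y) t (by
      obtain ⟨y, hy⟩ := hYne
      rw [Finset.ssubset_iff_of_subset Finset.subset_union_left]
      exact ⟨y, Finset.mem_union_right _ hy, ((hYmem y).1 hy).1.2⟩) ht
    rw [Finset.card_union_of_disjoint hdisj, mul_add] at hlt
    have hclass : ∀ j, π j = i → (i ∈ I → r (c i) = j → c i ∈ X) →
        (Odd (classWeight f X r j) → Odd (classWeight (fun _ => 1) X r j)) := by
      intro j hj hcj
      have hmemS : ∀ v, v ∉ X ∧ r v = j → v ∉ S ∧ p v = i := fun v hv =>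
        ⟨fun h => hv.1 (hSX h), by rw [← hπ, hv.2, hj]⟩
      have h1 := sum_rootedWeight (I := I) (c := c) hm1 (S := S) (p := p) (i := i)
        (s := Finset.univ.filter fun v => v ∉ X ∧ r v = j) fun v hv => hmemS v (by simpa using hv)
      rw [if_neg (fun h => by
        have h2 := h.2
        simp only [Finset.mem_filter, Finset.mem_univ, true_and] at h2
        exact h2.1 (hcj h.1 h2.2)), add_zero] at h1
      rw [classWeight_eq_sum (s := Finset.univ.filter fun v => v ∉ X ∧ r v = j)
        fun v => by simp, classWeight_eq_sum (s := Finset.univ.filter fun v => v ∉ X ∧ r v = j)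
        fun v => by simp, h1, Nat.odd_mul]
      intro h
      simpa using h.2
    by_cases hi : i ∈ I
    · have hpar := odd_card_oddColors_filter (X := X) (r := r) (fun j => π j = i)
        (Finset.univ.filter fun v => v ∉ X ∧ p v = i) fun v => by simp [hπ]
      have hsplit : (Finset.univ.filter fun v => v ∉ S ∧ p v = i).card =
          Y.card + (Finset.univ.filter fun v => v ∉ X ∧ p v = i).card := by
        rw [← Finset.card_union_of_disjoint]
        · congr 1
          ext v
          simp only [Finset.mem_filter, Finset.mem_univ, true_and, Finset.mem_union, hYmem]
          have := @hSX v
          tauto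
        · rw [Finset.disjoint_left]
          intro v h1 h2
          simp only [Finset.mem_filter, Finset.mem_univ, true_and] at h2
          exact h2.1 ((hYmem v).1 h1).1.1
      have hodd := hfull.2 hi
      rw [hsplit, Nat.odd_add, ← Nat.not_odd_iff_even, ← hpar] at hodd
      rw [Finset.card_erase_of_mem hi] at hcard
      have hIpos : 0 < I.card := Finset.card_pos.2 ⟨i, hi⟩
      have hne : {j ∈ oddColors (fun _ => 1) X r | π j = i}.card ≠ m * Y.card := by
        intro h
        rw [h, Nat.odd_mul] at hodd
        tauto
      by_cases hcX : c i ∈ X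
      · rw [if_pos ⟨hi, (hYmem _).2 ⟨⟨hcX, (hc i hi).1⟩, (hc i hi).2⟩⟩] at hYsum
        have hle : {j ∈ oddColors f X r | π j = i} ⊆
            {j ∈ oddColors (fun _ => 1) X r | π j = i} := by
          intro j hj
          rw [Finset.mem_filter, mem_oddColors] at hj ⊢
          exact ⟨hclass j hj.2 (fun _ _ => hcX) hj.1, hj.2⟩
        have := Finset.card_le_card hle
        omega
      · rw [if_neg (fun h => hcX ((hYmem _).1 h.2).1.1)] at hYsum
        have hle : {j ∈ oddColors f X r | π j = i} ⊆
            insert (r (c i)) {j ∈ oddColors (fun _ => 1) X r | π j = i} := by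
          intro j hj
          by_cases hjc : j = r (c i)
          · exact hjc ▸ Finset.mem_insert_self _ _
          · refine Finset.mem_insert_of_mem ?_
            rw [Finset.mem_filter, mem_oddColors] at hj ⊢
            exact ⟨hclass j hj.2 (fun _ h => absurd h.symm hjc) hj.1, hj.2⟩
        have := (Finset.card_le_card hle).trans (Finset.card_insert_le _ _)
        omega
    · rw [if_neg (fun h => hi h.1)] at hYsum
      rw [Finset.erase_eq_of_notMem hi] at hcard
      have hle : {j ∈ oddColors f X r | π j = i} ⊆
          {j ∈ oddColors (fun _ => 1) X r | π j = i} := by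
        intro j hj
        rw [Finset.mem_filter, mem_oddColors] at hj ⊢
        exact ⟨hclass j hj.2 (fun h => absurd h hi) hj.1, hj.2⟩
      have := Finset.card_le_card hle
      omega

open Classical in
/-- Each vertex of a maximal set `S` maximizing the deficiency takes `m` or `m + 1` odd components of
`G - S`, and a parity factor of `G - S` completes the subgraph. -/
lemma exists_factor_of_barrier [Nonempty V] {G : SimpleGraph V} {m : ℕ} (hm : Odd m) {S : Finset V}
    {p : V → ℕ} (hp : Separates G S p)
    (hfin : ∀ q, Separates G S q → ∀ u v, u ∉ S → v ∉ S → p u = p v → q u = q v)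
    (hbound : ∀ T t, Separates G T t → (oddColors (fun _ => 1) T t).card ≤ (m + 1) * T.card)
    (hmax : ∀ T t, Separates G T t → (oddColors (fun _ => 1) T t).card + m * S.card ≤
      (oddColors (fun _ => 1) S p).card + m * T.card)
    (hmax' : ∀ T t, S ⊂ T → Separates G T t → (oddColors (fun _ => 1) T t).card + m * S.card <
      (oddColors (fun _ => 1) S p).card + m * T.card) :
    ∃ F ≤ G, ∀ v, (Odd (F.neighborSet v).ncard ∧ (F.neighborSet v).ncard ≤ m) ∨
      (F.neighborSet v).ncard = m + 1 := by
  set I := oddColors (fun _ => 1) S p with hI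
  let rel : S → I → Prop := fun s i => ∃ v, v ∉ S ∧ p v = i ∧ G.Adj s v
  have hret : ∀ T : Finset S, ∃ U : Finset V, U.card = Tᶜ.card ∧ ∃ q, Separates G U q ∧
      I.card ≤ (T.biUnion fun a => {i | rel a i}).card + (oddColors (fun _ => 1) U q).card := by
    intro T
    obtain ⟨q, hq, hle⟩ := exists_separates_sdiff hp (T.map (Function.Embedding.subtype _))
      ((T.biUnion fun a => {i | rel a i}).map (Function.Embedding.subtype _)) (by
        intro s hs v hv hsv hpv
        obtain ⟨a, ha, rfl⟩ := Finset.mem_map.1 hs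
        exact Finset.mem_map.2 ⟨⟨p v, hpv⟩, Finset.mem_biUnion.2
          ⟨a, ha, Finset.mem_filter.2 ⟨Finset.mem_univ _, v, hv, rfl, hsv⟩⟩, rfl⟩)
    rw [Finset.card_map] at hle
    refine ⟨_, ?_, q, hq, hle⟩
    rw [Finset.card_sdiff_of_subset fun x hx => ?_, Finset.card_map, Finset.card_compl,
      Fintype.card_coe]
    obtain ⟨s, -, rfl⟩ := Finset.mem_map.1 hx
    exact s.2
  obtain ⟨φ, hφ, hdeg⟩ := exists_assignment rel m (fun T => by
      obtain ⟨U, hU, q, hq, hle⟩ := hret T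
      have h1 := hmax U q hq
      have h2 := Finset.card_add_card_compl T
      rw [Fintype.card_coe] at h2
      rw [hU, ← h2, mul_add] at h1
      omega) (fun T => by
      obtain ⟨U, hU, q, hq, hle⟩ := hret T
      have h1 := hbound U q hq
      rw [hU] at h1
      rw [Fintype.card_coe]
      omega)
  choose d hdS hdp hdadj using hφ
  obtain ⟨c, hcd⟩ : ∃ c : ℕ → V, ∀ i : I, c i = d i :=
    ⟨fun i => if h : i ∈ I then d ⟨i, h⟩ else Classical.arbitrary V, fun i => by simp⟩
  have hc : ∀ i ∈ I, c i ∉ S ∧ p (c i) = i := fun i hi =>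
    hcd ⟨i, hi⟩ ▸ ⟨hdS ⟨i, hi⟩, hdp ⟨i, hi⟩⟩
  set f := rootedWeight m S p I c with hf
  have hfS : ∀ v ∈ S, f v = 0 := fun v hv => by simp [hf, rootedWeight, hv]
  obtain ⟨F, hFG, hF⟩ := exists_parity_factor G f (by
    intro X q hX hq
    have hSX : S ⊆ X := fun v hv => hX v (hfS v hv)
    have hr : Separates G X fun v => Nat.pair (p v) (q v) := fun u v hu hv huv => by
      simp only [hp u v (fun h => hu (hSX h)) (fun h => hv (hSX h)) huv, hq u v hu hv huv]
    have href : (oddColors f X q).card ≤ (oddColors f X fun v => Nat.pair (p v) (q v)).card :=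
      card_oddColors_le_of_refines fun u v _ _ huv => (Nat.pair_eq_pair.1 huv).2
    refine href.trans ?_
    rw [Finset.card_eq_sum_card_fiberwise (f := fun j => (Nat.unpair j).1)
      (t := Finset.univ.image p) (fun j hj => by
        obtain ⟨v, -, rfl⟩ := exists_of_odd_classWeight (mem_oddColors.1 hj)
        simp)]
    refine (Finset.sum_le_sum fun i _ => card_filter_oddColors_le hm (fun j => (Nat.unpair j).1)
      hSX hp hfin hmax' hc hr (fun v => by simp) i).trans ?_
    rw [Finset.sum_fiberwise_of_maps_to (fun v _ => Finset.mem_image_of_mem p (Finset.mem_univ v))]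
    exact Finset.sum_le_sum_of_subset Finset.sdiff_subset)
  have hFS : ∀ u v, F.Adj u v → u ∉ S := by
    intro u v huv hu
    have h1 := (hF u).1
    rw [hfS u hu, Nat.le_zero, Set.ncard_eq_zero] at h1
    exact Set.notMem_empty v (h1 ▸ huv)
  let E : V → V → Prop := fun u v => ∃ i : I, u = d i ∧ v = φ i
  have hEG : ∀ u v, E u v → G.Adj u v := by
    rintro _ _ ⟨i, rfl, rfl⟩
    exact (hdadj i).symm
  let F' : SimpleGraph V :=
    { Adj := fun u v => F.Adj u v ∨ E u v ∨ E v u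
      symm := ⟨fun u v h => h.imp SimpleGraph.Adj.symm Or.symm⟩
      loopless := ⟨fun u h => h.elim F.irrefl fun h => G.irrefl (h.elim (hEG u u) (hEG u u))⟩ }
  refine ⟨F', fun u v h => h.elim (fun h => hFG h)
    fun h => h.elim (hEG u v) fun h => (hEG v u h).symm, fun v => ?_⟩
  by_cases hvS : v ∈ S
  · have hN : (F'.neighborSet v).ncard =
        (Finset.univ.filter fun i => φ i = ⟨v, hvS⟩).card := by
      have hdinj : Function.Injective d := fun i j hij =>
        Subtype.ext (by rw [← hdp i, ← hdp j, hij])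
      rw [← Set.ncard_coe_finset, ← Set.ncard_image_of_injective _ hdinj]
      congr 1
      ext w
      simp only [mem_neighborSet, Set.mem_image, Finset.coe_filter, Finset.mem_univ, true_and,
        Set.mem_ofPred_eq]
      constructor
      · rintro (h | ⟨i, rfl, -⟩ | ⟨i, rfl, h⟩)
        · exact absurd hvS (hFS v w h)
        · exact absurd hvS (hdS i)
        · exact ⟨i, Subtype.ext h.symm, rfl⟩
      · rintro ⟨i, hi, rfl⟩
        exact Or.inr (Or.inr ⟨i, rfl, by rw [hi]⟩)
    obtain ⟨h1, h2⟩ := hdeg ⟨v, hvS⟩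
    rw [hN]
    rcases h1.eq_or_lt with h | h
    · exact Or.inl ⟨h ▸ hm, h.ge⟩
    · exact Or.inr (le_antisymm h2 h)
  · left
    by_cases hv : p v ∈ I ∧ c (p v) = v
    · obtain ⟨hi, hcv⟩ := hv
      have hdv : d ⟨p v, hi⟩ = v := (hcd ⟨p v, hi⟩).symm.trans hcv
      have hN : F'.neighborSet v = insert (φ ⟨p v, hi⟩ : V) (F.neighborSet v) := by
        ext w
        simp only [mem_neighborSet, Set.mem_insert_iff]
        constructor
        · rintro (h | ⟨i, h, rfl⟩ | ⟨i, rfl, rfl⟩)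
          · exact Or.inr h
          · have : i = ⟨p v, hi⟩ := Subtype.ext ((hdp i).symm.trans (congrArg p h.symm))
            exact Or.inl (by rw [this])
          · exact absurd (φ i).2 hvS
        · rintro (rfl | h)
          · exact Or.inr (Or.inl ⟨⟨p v, hi⟩, hdv.symm, rfl⟩)
          · exact Or.inl h
      have hnot : (φ ⟨p v, hi⟩ : V) ∉ F.neighborSet v := fun h =>
        hFS _ _ (SimpleGraph.Adj.symm h) (φ ⟨p v, hi⟩).2
      have hfv : f v = m - 1 := by simp [hf, rootedWeight, hvS, hi, hcv]
      obtain ⟨h1, h2⟩ := hF v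
      rw [hN, Set.ncard_insert_of_notMem hnot]
      rw [hfv] at h1 h2
      obtain ⟨k, rfl⟩ := hm
      rw [Nat.add_sub_cancel] at h1 h2
      refine ⟨?_, by omega⟩
      rw [Nat.odd_add_one, h2]
      simp
    · have hN : F'.neighborSet v = F.neighborSet v := by
        ext w
        simp only [mem_neighborSet]
        refine ⟨?_, Or.inl⟩
        rintro (h | ⟨i, rfl, rfl⟩ | ⟨i, rfl, rfl⟩)
        · exact h
        · exact absurd ⟨(hdp i).symm ▸ i.2, by rw [hdp, hcd]⟩ hv
        · exact absurd (φ i).2 hvS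
      have hfv : f v = m := by simp only [hf, rootedWeight, if_neg hvS, if_neg hv]
      obtain ⟨h1, h2⟩ := hF v
      rw [hN]
      rw [hfv] at h1 h2
      exact ⟨h2.2 hm, h1⟩

end Barrier

end HnFactor

open HnFactor in
theorem stmt_0 {V : Type*} [Fintype V] (n : ℕ) (hn : 1 ≤ n) (G : SimpleGraph V)
    (hno : ∀ c : G.ConnectedComponent, ¬ Odd (Nat.card c.supp))
    (hS : ∀ S : Set V, S.Nonempty →
      oddComponentCount (G.induce Sᶜ) ≤ 2 * n * S.ncard) :
    ∃ F, IsHnFactor n G F := by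
  classical
  obtain ⟨m, hm⟩ : ∃ m, 2 * n = m + 1 := ⟨2 * n - 1, by omega⟩
  have hmodd : Odd m := ⟨n - 1, by omega⟩
  rcases isEmpty_or_nonempty V with hV | hV
  · exact ⟨⊥, bot_le, fun v => hV.elim v⟩
  choose P hsep hfin hcard using fun S : Finset V =>
    exists_finest_coloring G (G.induce (S : Set V)ᶜ) Subtype.val Subtype.val_injective S
      (fun v => by simp) (fun a b => Iff.rfl)
  have hle : ∀ T q, Separates G T q →
      (oddColors (fun _ => 1) T q).card ≤ (oddColors (fun _ => 1) T (P T)).card :=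
    fun T q hq => card_oddColors_le_of_refines (hfin T q hq)
  have hbound : ∀ T q, Separates G T q →
      (oddColors (fun _ => 1) T q).card ≤ (m + 1) * T.card := by
    intro T q hq
    rcases T.eq_empty_or_nonempty with rfl | hT
    · obtain ⟨p, -, hpfin, hp⟩ := exists_finest_coloring G G id Function.injective_id ∅
        (fun v => by simp) (fun a b => Iff.rfl)
      have : IsEmpty {c : G.ConnectedComponent // Odd (Nat.card c.supp)} :=
        ⟨fun c => hno c.1 c.2⟩
      rw [Nat.card_of_isEmpty] at hp
      have := card_oddColors_le_of_refines (f := fun _ => 1) (hpfin q hq)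
      omega
    · have h1 := hS T hT
      rw [Set.ncard_coe_finset, hm] at h1
      exact ((hle T q hq).trans_eq (hcard T)).trans h1
  obtain ⟨S, -, hSmax⟩ := Finset.exists_max_image (Finset.univ : Finset (Finset V))
    (fun T => toLex (((oddColors (fun _ => 1) T (P T)).card : ℤ) - m * T.card, T.card))
    Finset.univ_nonempty
  simp only [Finset.mem_univ, Prod.Lex.le_iff, ofLex_toLex, forall_true_left] at hSmax
  obtain ⟨F, hFG, hF⟩ := exists_factor_of_barrier hmodd (hsep S) (hfin S) hbound
    (fun T t ht => by
      have h1 := hle T t ht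
      zify at h1 ⊢
      rcases hSmax T with h | h <;> linarith)
    (fun T t hST ht => by
      have h1 := hle T t ht
      have h2 := Finset.card_lt_card hST
      zify at h1 ⊢
      rcases hSmax T with h | h
      · linarith
      · omega)
  refine ⟨F, hFG, fun v => ?_⟩
  rw [hm, Nat.add_sub_cancel]
  exact hF v
end

section
/- Let G be a k-connected graph with an even number g of vertices, and let u, v be non-adjacent vertices of G with |N_G(u) ∪ N_G(v)| ≥ g − 2nk. If G + uv has an H_n-factor, then G has an H_n-factor. -/
open SimpleGraph

/-- A graph is `k`-connected if it has more than `k` vertices and remains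
connected after deleting any set of fewer than `k` vertices. -/
def KConnected {V : Type*} [Fintype V] (k : ℕ) (G : SimpleGraph V) : Prop :=
  k < Fintype.card V ∧ ∀ S : Set V, S.ncard < k → (G.induce Sᶜ).Connected

/-- The degree of `w` in `F`, as a natural number. -/
noncomputable abbrev ndeg {V : Type*} (F : SimpleGraph V) (w : V) : ℕ := (F.neighborSet w).ncard

/-- The degrees admissible in an `Hₙ`-factor. -/
def HnDegree (n d : ℕ) : Prop := (Odd d ∧ d ≤ 2 * n - 1) ∨ d = 2 * n

/-- The graph `F` with the status of the pair `x y` reversed. -/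
def toggle {V : Type*} (F : SimpleGraph V) (x y : V) : SimpleGraph V where
  Adj a b := (F.Adj a b ∧ s(a, b) ≠ s(x, y)) ∨ (¬ F.Adj a b ∧ s(a, b) = s(x, y) ∧ a ≠ b)
  symm := ⟨fun a b h => by rwa [F.adj_comm b a, Sym2.eq_swap (a := b), ne_comm (a := b)]⟩
  loopless := ⟨fun a h => by simp at h⟩

section Toggle

variable {V : Type*} {F G : SimpleGraph V} {x y : V}

lemma toggle_adj {a b : V} : (toggle F x y).Adj a b ↔
    (F.Adj a b ∧ s(a, b) ≠ s(x, y)) ∨ (¬ F.Adj a b ∧ s(a, b) = s(x, y) ∧ a ≠ b) := Iff.rfl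

lemma toggle_comm : toggle F x y = toggle F y x := by
  ext a b
  simp only [toggle_adj, Sym2.eq_swap (a := x)]

lemma toggle_adj_of_ne {a b : V} (h : s(a, b) ≠ s(x, y)) :
    (toggle F x y).Adj a b ↔ F.Adj a b := by
  simp [toggle_adj, h]

lemma toggle_adj_self (h : x ≠ y) : (toggle F x y).Adj x y ↔ ¬ F.Adj x y := by
  simp [toggle_adj, h]

lemma toggle_le (hF : F ≤ G) (h : G.Adj x y) : toggle F x y ≤ G := by
  rintro a b (⟨hab, -⟩ | ⟨-, hab, -⟩)
  · exact hF hab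
  · rwa [← SimpleGraph.mem_edgeSet, hab]

lemma ndeg_toggle_of_ne {w : V} (hx : w ≠ x) (hy : w ≠ y) :
    ndeg (toggle F x y) w = ndeg F w := by
  have : (toggle F x y).neighborSet w = F.neighborSet w := by
    ext b
    exact toggle_adj_of_ne (by simp [hx, hy])
  rw [ndeg, this]

lemma ndeg_toggle_left_of_adj [Finite V] (h : F.Adj x y) :
    ndeg (toggle F x y) x + 1 = ndeg F x := by
  have : (toggle F x y).neighborSet x = F.neighborSet x \ {y} := by
    ext b
    simp only [mem_neighborSet, toggle_adj, Set.mem_sdiff, Set.mem_singleton_iff, Sym2.eq_iff]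
    grind
  rw [ndeg, this]
  exact Set.ncard_sdiff_singleton_add_one h (Set.toFinite _)

lemma ndeg_toggle_left_of_not_adj [Finite V] (hne : x ≠ y) (h : ¬ F.Adj x y) :
    ndeg (toggle F x y) x = ndeg F x + 1 := by
  have : (toggle F x y).neighborSet x = insert y (F.neighborSet x) := by
    ext b
    simp only [mem_neighborSet, toggle_adj, Set.mem_insert_iff, Sym2.eq_iff]
    grind
  rw [ndeg, this]
  exact Set.ncard_insert_of_notMem h (Set.toFinite _)

lemma ndeg_toggle_right_of_adj [Finite V] (h : F.Adj x y) :
    ndeg (toggle F x y) y + 1 = ndeg F y := by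
  rw [toggle_comm]
  exact ndeg_toggle_left_of_adj h.symm

lemma ndeg_toggle_right_of_not_adj [Finite V] (hne : x ≠ y) (h : ¬ F.Adj x y) :
    ndeg (toggle F x y) y = ndeg F y + 1 := by
  rw [toggle_comm]
  exact ndeg_toggle_left_of_not_adj hne.symm fun h' => h h'.symm

end Toggle

/-- `G` with all edges meeting `T` removed. -/
def isolate {V : Type*} (G : SimpleGraph V) (T : Set V) : SimpleGraph V where
  Adj a b := G.Adj a b ∧ a ∉ T ∧ b ∉ T
  symm := ⟨fun _ _ h => ⟨h.1.symm, h.2.2, h.2.1⟩⟩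
  loopless := ⟨fun _ h => h.1.ne rfl⟩

/-- The component of `a` in `G` after isolating the vertices of `T`. -/
abbrev isoComp {V : Type*} (G : SimpleGraph V) (T : Set V) (a : V) :
    (isolate G T).ConnectedComponent := (isolate G T).connectedComponentMk a

/-- A subgraph `F` of `G` whose degrees are at most `2 * n`, attained exactly on `T`, and which
misses the admissible degrees of an `Hₙ`-factor exactly on `W ∪ {x}`. -/
structure IsNearFactor {V : Type*} (n : ℕ) (G : SimpleGraph V) (T W : Set V)
    (F : SimpleGraph V) (x : V) : Prop where
  le : F ≤ G
  notMem_T : x ∉ T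
  notMem_W : x ∉ W
  defect : ndeg F x % 2 = 0 ∧ ndeg F x + 2 ≤ 2 * n
  of_mem_W : ∀ w ∈ W, ndeg F w % 2 = 0 ∧ ndeg F w + 2 ≤ 2 * n
  of_mem_T : ∀ w ∈ T, ndeg F w = 2 * n
  of_notMem : ∀ w, w ∉ T → w ∉ W → w ≠ x → ndeg F w % 2 = 1 ∧ ndeg F w + 1 ≤ 2 * n

/-- No subgraph of `G` has degrees at most `2 * n` and all its defects in `W`. -/
def NoSmallerDefect {V : Type*} (n : ℕ) (G : SimpleGraph V) (W : Set V) : Prop :=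
  ∀ F ≤ G, (∀ w, ndeg F w ≤ 2 * n) → (∀ w ∉ W, HnDegree n (ndeg F w)) → False

/-- Moving the defect of a near factor to a neighbor, or to a second neighbor through `T`. -/
def DefectStep {V : Type*} (G : SimpleGraph V) (T : Set V) (s t : SimpleGraph V × V) : Prop :=
  (t.2 ∉ T ∧ G.Adj s.2 t.2 ∧ t.1 = toggle s.1 s.2 t.2) ∨
    ∃ y ∈ T, G.Adj s.2 y ∧ s.1.Adj y t.2 ∧ t.1 = toggle (toggle s.1 s.2 y) y t.2

section NearFactor

variable {V : Type*} {n : ℕ} {G F : SimpleGraph V} {T W : Set V} {x y z : V}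

lemma HnDegree.of_odd {d : ℕ} (h : d % 2 = 1) (h' : d + 1 ≤ 2 * n) : HnDegree n d :=
  Or.inl ⟨Nat.odd_iff.2 h, by omega⟩

lemma IsNearFactor.ndeg_le (h : IsNearFactor n G T W F x) (w : V) : ndeg F w ≤ 2 * n := by
  have h1 := h.defect
  have h2 := h.of_mem_W w
  have h3 := h.of_mem_T w
  have h4 := h.of_notMem w
  by_cases hx : w = x
  · subst hx; omega
  by_cases hT : w ∈ T
  · exact (h3 hT).le
  by_cases hW : w ∈ W
  · have := h2 hW; omega
  · have := h4 hT hW hx; omega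

lemma IsNearFactor.hnDegree (h : IsNearFactor n G T W F x) {w : V} (hW : w ∉ W) (hx : w ≠ x) :
    HnDegree n (ndeg F w) := by
  by_cases hT : w ∈ T
  · exact Or.inr (h.of_mem_T w hT)
  · exact .of_odd (h.of_notMem w hT hW hx).1 (h.of_notMem w hT hW hx).2

lemma isoComp_eq_of_adj {a b : V} (h : G.Adj a b) (ha : a ∉ T) (hb : b ∉ T) :
    isoComp G T a = isoComp G T b :=
  ConnectedComponent.sound (Adj.reachable (G := isolate G T) ⟨h, ha, hb⟩)

lemma notMem_of_isoComp_eq {a b : V} (h : isoComp G T a = isoComp G T b) (ha : a ∉ T) :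
    b ∉ T := by
  have h' : (isolate G T).Reachable a b := ConnectedComponent.exact h
  rw [reachable_iff_reflTransGen] at h'
  induction h' with
  | refl => exact ha
  | tail _ hbc _ => exact hbc.2.2

/-- The defect can be moved anywhere within its component, without changing edges at `T`. -/
lemma exists_steps_of_isoComp_eq (s : SimpleGraph V × V) (hs : s.2 ∉ T)
    (h : isoComp G T s.2 = isoComp G T z) :
    ∃ F', Relation.ReflTransGen (DefectStep G T) s (F', z) ∧
      ∀ y ∈ T, ∀ b, F'.Adj y b ↔ s.1.Adj y b := by
  have h' : (isolate G T).Reachable s.2 z := ConnectedComponent.exact h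
  clear h
  rw [reachable_iff_reflTransGen] at h'
  induction h' with
  | refl => exact ⟨s.1, .refl, fun _ _ _ => Iff.rfl⟩
  | @tail b c _ hbc ih =>
    obtain ⟨F', h1, h2⟩ := ih
    refine ⟨toggle F' b c, h1.tail (Or.inl ⟨hbc.2.2, hbc.1, rfl⟩), fun y hy a => ?_⟩
    rw [← h2 y hy a]
    refine toggle_adj_of_ne ?_
    have := hbc.2
    rw [Ne, Sym2.eq_iff]
    grind

/-- The vertices to which the defect can be moved. -/
def defectSet (G : SimpleGraph V) (T : Set V) (s : SimpleGraph V × V) : Set V :=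
  {x | ∃ F, Relation.ReflTransGen (DefectStep G T) s (F, x)}

lemma adj_iff_of_notMem_defectSet
    {s t : SimpleGraph V × V} (hst : Relation.ReflTransGen (DefectStep G T) s t) {a b : V}
    (ha : a ∉ defectSet G T s) (hb : b ∉ defectSet G T s) : t.1.Adj a b ↔ s.1.Adj a b := by
  induction hst with
  | refl => rfl
  | @tail p q hp hpq ih =>
    rw [← ih]
    have h1 : p.2 ∈ defectSet G T s := ⟨p.1, hp⟩
    have h2 : q.2 ∈ defectSet G T s := ⟨q.1, hp.tail hpq⟩
    rcases hpq with ⟨-, -, h3⟩ | ⟨y, -, -, -, h3⟩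
    · rw [h3]
      refine toggle_adj_of_ne ?_
      rw [Ne, Sym2.eq_iff]
      grind
    · rw [h3, toggle_adj_of_ne, toggle_adj_of_ne]
      all_goals
        rw [Ne, Sym2.eq_iff]
        grind

lemma mem_defectSet_of_isoComp_eq {s : SimpleGraph V × V} {a b : V}
    (ha : a ∈ defectSet G T s) (haT : a ∉ T) (h : isoComp G T a = isoComp G T b) :
    b ∈ defectSet G T s := by
  obtain ⟨F, hF⟩ := ha
  obtain ⟨F', h1, -⟩ := exists_steps_of_isoComp_eq (F, a) haT h
  exact ⟨F', hF.trans h1⟩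

variable [Finite V]

lemma IsNearFactor.toggle_defect (h : IsNearFactor n G T W F x) (hxy : G.Adj x y) :
    ndeg (toggle F x y) x % 2 = 1 ∧ ndeg (toggle F x y) x + 1 ≤ 2 * n := by
  have h1 := h.defect
  by_cases hF : F.Adj x y
  · have := ndeg_toggle_left_of_adj hF
    omega
  · have := ndeg_toggle_left_of_not_adj hxy.ne hF
    omega

/-- Reversing `x y` removes the defect at `x`, so it has to create one at `y`. -/
lemma IsNearFactor.not_hnDegree_toggle (hmin : NoSmallerDefect n G W)
    (h : IsNearFactor n G T W F x) (hxy : G.Adj x y) :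
    ¬ (ndeg (toggle F x y) y ≤ 2 * n ∧ HnDegree n (ndeg (toggle F x y) y)) := by
  rintro ⟨hy, hy'⟩
  have hx := h.toggle_defect hxy
  refine hmin (toggle F x y) (toggle_le h.le hxy) (fun w => ?_) (fun w hw => ?_)
  · by_cases hwx : w = x
    · subst hwx; omega
    by_cases hwy : w = y
    · subst hwy; exact hy
    rw [ndeg_toggle_of_ne hwx hwy]
    exact h.ndeg_le w
  · by_cases hwx : w = x
    · subst hwx; exact .of_odd hx.1 hx.2
    by_cases hwy : w = y
    · subst hwy; exact hy'
    rw [ndeg_toggle_of_ne hwx hwy]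
    exact h.hnDegree hw hwx

lemma IsNearFactor.not_adj_of_mem_T (hmin : NoSmallerDefect n G W)
    (h : IsNearFactor n G T W F x) (hy : y ∈ T) : ¬ F.Adj x y := by
  intro hF
  have h1 := ndeg_toggle_right_of_adj hF
  have h2 := h.of_mem_T y hy
  have h3 := h.defect
  exact h.not_hnDegree_toggle hmin (h.le hF) ⟨by omega, .of_odd (by omega) (by omega)⟩

lemma IsNearFactor.notMem_W_of_adj (hmin : NoSmallerDefect n G W)
    (h : IsNearFactor n G T W F x) (hxy : G.Adj x y) : y ∉ W := by
  intro hy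
  have h1 := h.of_mem_W y hy
  refine h.not_hnDegree_toggle hmin hxy ?_
  by_cases hF : F.Adj x y
  · have := ndeg_toggle_right_of_adj hF
    exact ⟨by omega, .of_odd (by omega) (by omega)⟩
  · have := ndeg_toggle_right_of_not_adj hxy.ne hF
    exact ⟨by omega, .of_odd (by omega) (by omega)⟩

lemma IsNearFactor.move (hmin : NoSmallerDefect n G W)
    (h : IsNearFactor n G T W F x) (hxy : G.Adj x y) (hy : y ∉ T) :
    IsNearFactor n G T W (toggle F x y) y := by
  have hyW := h.notMem_W_of_adj hmin hxy
  have hd := h.of_notMem y hy hyW hxy.ne'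
  have hx := h.toggle_defect hxy
  have hno := h.not_hnDegree_toggle hmin hxy
  refine ⟨toggle_le h.le hxy, hy, hyW, ?_, fun w hw => ?_, fun w hw => ?_, fun w hT hW hwy => ?_⟩
  · by_cases hF : F.Adj x y
    · have := ndeg_toggle_right_of_adj hF
      omega
    · have := ndeg_toggle_right_of_not_adj hxy.ne hF
      by_cases h2 : ndeg (toggle F x y) y = 2 * n
      · exact absurd ⟨h2.le, Or.inr h2⟩ hno
      · omega
  · rw [ndeg_toggle_of_ne (by grind [h.notMem_W]) (by grind)]
    exact h.of_mem_W w hw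
  · rw [ndeg_toggle_of_ne (by grind [h.notMem_T]) (by grind)]
    exact h.of_mem_T w hw
  · by_cases hwx : w = x
    · subst hwx; exact hx
    · rw [ndeg_toggle_of_ne hwx hwy]
      exact h.of_notMem w hT hW hwx

lemma IsNearFactor.move_through (hmin : NoSmallerDefect n G W)
    (h : IsNearFactor n G T W F x) (hxy : G.Adj x y) (hy : y ∈ T) (hyz : F.Adj y z) :
    IsNearFactor n G T W (toggle (toggle F x y) y z) z := by
  have hF := h.not_adj_of_mem_T hmin hy
  have hzx : z ≠ x := by rintro rfl; exact hF hyz.symm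
  have hdy := h.of_mem_T y hy
  have hx := h.toggle_defect hxy
  have hyz' : (toggle F x y).Adj y z :=
    (toggle_adj_of_ne (by simp [hzx, hxy.ne'])).2 hyz
  have hle := toggle_le (toggle_le h.le hxy) (h.le hyz)
  have ey : ndeg (toggle (toggle F x y) y z) y = 2 * n := by
    have h1 := ndeg_toggle_left_of_adj hyz'
    have h2 := ndeg_toggle_right_of_not_adj hxy.ne hF
    omega
  have ez : ndeg (toggle (toggle F x y) y z) z + 1 = ndeg F z := by
    rw [ndeg_toggle_right_of_adj hyz', ndeg_toggle_of_ne hzx hyz.ne']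
  have ex : ndeg (toggle (toggle F x y) y z) x = ndeg (toggle F x y) x :=
    ndeg_toggle_of_ne hxy.ne hzx.symm
  have eo : ∀ w, w ≠ x → w ≠ y → w ≠ z →
      ndeg (toggle (toggle F x y) y z) w = ndeg F w := fun w h1 h2 h3 => by
    rw [ndeg_toggle_of_ne h2 h3, ndeg_toggle_of_ne h1 h2]
  have hz : ¬ HnDegree n (ndeg (toggle (toggle F x y) y z) z) := by
    intro hz
    refine hmin _ hle (fun w => ?_) (fun w hw => ?_)
    · by_cases h1 : w = x
      · subst h1; omega
      by_cases h2 : w = y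
      · exact h2 ▸ ey.le
      by_cases h3 : w = z
      · subst h3; have := h.ndeg_le w; omega
      rw [eo w h1 h2 h3]
      exact h.ndeg_le w
    · by_cases h1 : w = x
      · subst h1; rw [ex]; exact .of_odd hx.1 hx.2
      by_cases h2 : w = y
      · subst h2; exact Or.inr ey
      by_cases h3 : w = z
      · subst h3; exact hz
      rw [eo w h1 h2 h3]
      exact h.hnDegree hw h1
  have hzT : z ∉ T := fun hzT => hz <| by
    have h1 := h.of_mem_T z hzT
    have h2 := h.defect
    exact .of_odd (by omega) (by omega)
  have hzW : z ∉ W := fun hzW => hz <| by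
    have h1 := h.of_mem_W z hzW
    exact .of_odd (by omega) (by omega)
  have hdz := h.of_notMem z hzT hzW hzx
  refine ⟨hle, hzT, hzW, by omega, fun w hw => ?_, fun w hw => ?_, fun w hT hW hwz => ?_⟩
  · have hwy : w ≠ y := by
      rintro rfl
      have := h.of_mem_W w hw
      omega
    rw [eo w (by grind [h.notMem_W]) hwy (by grind)]
    exact h.of_mem_W w hw
  · by_cases hwy : w = y
    · subst hwy; exact ey
    rw [eo w (by grind [h.notMem_T]) hwy (by grind)]
    exact h.of_mem_T w hw
  · by_cases hwx : w = x
    · subst hwx; rw [ex]; exact hx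
    rw [eo w hwx (by grind) hwz]
    exact h.of_notMem w hT hW hwx

lemma IsNearFactor.step (hmin : NoSmallerDefect n G W) {s t : SimpleGraph V × V}
    (h : IsNearFactor n G T W s.1 s.2) (hst : DefectStep G T s t) :
    IsNearFactor n G T W t.1 t.2 := by
  rcases hst with ⟨h1, h2, h3⟩ | ⟨y, hy, h1, h2, h3⟩
  · rw [h3]; exact h.move hmin h2 h1
  · rw [h3]; exact h.move_through hmin h1 hy h2

lemma IsNearFactor.steps (hmin : NoSmallerDefect n G W) {s t : SimpleGraph V × V}
    (h : IsNearFactor n G T W s.1 s.2) (hst : Relation.ReflTransGen (DefectStep G T) s t) :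
    IsNearFactor n G T W t.1 t.2 := by
  induction hst with
  | refl => exact h
  | tail _ hbc ih => exact ih.step hmin hbc

/-- In the component of the defect no edge of the near factor leads to `T`. -/
lemma IsNearFactor.not_adj_of_isoComp_eq (hmin : NoSmallerDefect n G W)
    (h : IsNearFactor n G T W F x) (hy : y ∈ T) (hz : isoComp G T z = isoComp G T x) :
    ¬ F.Adj y z := by
  intro hyz
  obtain ⟨F', h1, h2⟩ := exists_steps_of_isoComp_eq (F, x) h.notMem_T hz.symm
  exact (h.steps (s := (F, x)) hmin h1).not_adj_of_mem_T hmin hy ((h2 y hy z).2 hyz).symm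

/-- At most one edge, or none if the defect is there, joins the component `C` to `T`. -/
def AlmostSeparated (G : SimpleGraph V) (T : Set V) (C : (isolate G T).ConnectedComponent)
    (s : SimpleGraph V × V) : Prop :=
  (∀ y ∈ T, ∀ y' ∈ T, ∀ z z', isoComp G T z = C → isoComp G T z' = C →
    s.1.Adj y z → s.1.Adj y' z' → y = y' ∧ z = z') ∧
  (isoComp G T s.2 = C → ∀ y ∈ T, ∀ z, isoComp G T z = C → ¬ s.1.Adj y z)

lemma AlmostSeparated.of_step (hmin : NoSmallerDefect n G W)
    {C : (isolate G T).ConnectedComponent} {s t : SimpleGraph V × V}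
    (hs : IsNearFactor n G T W s.1 s.2) (hst : DefectStep G T s t)
    (ht : AlmostSeparated G T C t) : AlmostSeparated G T C s := by
  have htT := (hs.step hmin hst).notMem_T
  have hsT := hs.notMem_T
  obtain ⟨F, x⟩ := s
  obtain ⟨F', w⟩ := t
  rcases hst with ⟨h1, h2, h3⟩ | ⟨y, hy, h1, h2, h3⟩
  · dsimp only at *
    have hcomp := isoComp_eq_of_adj h2 hsT h1
    have key : ∀ y ∈ T, ∀ b, F'.Adj y b ↔ F.Adj y b := fun y hy b => by
      rw [h3]
      refine toggle_adj_of_ne ?_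
      rw [Ne, Sym2.eq_iff]
      grind
    refine ⟨fun y hy y' hy' z z' hz hz' h4 h5 => ?_, fun hx y hy z hz h4 => ?_⟩
    · exact ht.1 y hy y' hy' z z' hz hz' ((key y hy z).2 h4) ((key y' hy' z').2 h5)
    · exact ht.2 (hcomp ▸ hx) y hy z hz ((key y hy z).2 h4)
  · dsimp only at *
    have hF := hs.not_adj_of_mem_T hmin hy
    have hxy := h1.ne
    have hwx : w ≠ x := by rintro rfl; exact hF h2.symm
    have hnew : F'.Adj y x := by
      rw [h3, toggle_adj_of_ne (by rw [Ne, Sym2.eq_iff]; grind), adj_comm, toggle_adj_self hxy]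
      exact hF
    have key : ∀ y' ∈ T, ∀ b, F.Adj y' b → (y' = y ∧ b = w) ∨ F'.Adj y' b := by
      intro y' hy' b hb
      by_cases hq : y' = y ∧ b = w
      · exact Or.inl hq
      · refine Or.inr ?_
        rw [h3, toggle_adj_of_ne, toggle_adj_of_ne]
        · exact hb
        · rw [Ne, Sym2.eq_iff]
          have hyx : b = y → y' ≠ x := by grind
          have hyx' : y' = y → b ≠ x := by
            rintro rfl rfl
            exact hF hb.symm
          grind
        · rw [Ne, Sym2.eq_iff]
          grind
    refine ⟨fun a ha a' ha' z z' hz hz' h4 h5 => ?_, fun hx a ha z hz h4 => ?_⟩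
    · rcases key a ha z h4 with ⟨rfl, rfl⟩ | h4'
      · rcases key a' ha' z' h5 with ⟨rfl, rfl⟩ | h5'
        · exact ⟨rfl, rfl⟩
        · exact absurd h5' (ht.2 hz a' ha' z' hz')
      · rcases key a' ha' z' h5 with ⟨rfl, rfl⟩ | h5'
        · exact absurd h4' (ht.2 hz' a ha z hz)
        · exact ht.1 a ha a' ha' z z' hz hz' h4' h5'
    · rcases key a ha z h4 with ⟨rfl, rfl⟩ | h4'
      · exact ht.2 hz a ha x hx hnew
      · obtain ⟨rfl, rfl⟩ := ht.1 a ha y hy z x hz hx h4' hnew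
        exact hF h4.symm

lemma AlmostSeparated.of_mem_defectSet (hmin : NoSmallerDefect n G W)
    {s : SimpleGraph V × V} (hs : IsNearFactor n G T W s.1 s.2) (hz : z ∈ defectSet G T s) :
    AlmostSeparated G T (isoComp G T z) s := by
  obtain ⟨F, hF⟩ := hz
  have hzF : IsNearFactor n G T W F z := hs.steps (t := (F, z)) hmin hF
  induction hF using Relation.ReflTransGen.head_induction_on with
  | refl =>
    have hno : ∀ y ∈ T, ∀ z', isoComp G T z' = isoComp G T z → ¬ F.Adj y z' :=
      fun y hy z' hz' => hzF.not_adj_of_isoComp_eq hmin hy hz'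
    exact ⟨fun y hy _ _ z _ hz _ h4 => absurd h4 (hno y hy z hz), fun _ => hno⟩
  | head hab _ ih => exact .of_step hmin hs hab (ih (hs.step hmin hab))

/-- The component of the defect has no `Hₙ`-factor. -/
lemma IsNearFactor.isoComp_critical (hmin : NoSmallerDefect n G W)
    (h : IsNearFactor n G T W F x) {K : SimpleGraph V} (hK : K ≤ G)
    (hKC : ∀ a b, K.Adj a b → isoComp G T a = isoComp G T x)
    (hdeg : ∀ a, isoComp G T a = isoComp G T x → HnDegree n (ndeg K a)) : False := by
  have hleave : ∀ a b, F.Adj a b → isoComp G T a = isoComp G T x →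
      isoComp G T b = isoComp G T x := by
    intro a b hab ha
    have haT := notMem_of_isoComp_eq ha.symm h.notMem_T
    by_cases hb : b ∈ T
    · exact absurd hab.symm (h.not_adj_of_isoComp_eq hmin hb ha)
    · rw [← ha, isoComp_eq_of_adj (h.le hab) haT hb]
  let F' : SimpleGraph V :=
    { Adj := fun a b => K.Adj a b ∨ (F.Adj a b ∧ isoComp G T a ≠ isoComp G T x)
      symm := ⟨fun a b => by
        rintro (hab | ⟨hab, ha⟩)
        · exact Or.inl hab.symm
        · exact Or.inr ⟨hab.symm, fun hb => ha (hleave b a hab.symm hb)⟩⟩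
      loopless := ⟨fun a ha => by simp at ha⟩ }
  have hin : ∀ a, isoComp G T a = isoComp G T x → ndeg F' a = ndeg K a := by
    intro a ha
    have : F'.neighborSet a = K.neighborSet a := by
      ext b
      change K.Adj a b ∨ (F.Adj a b ∧ _) ↔ K.Adj a b
      tauto
    rw [ndeg, this]
  have hout : ∀ a, isoComp G T a ≠ isoComp G T x → ndeg F' a = ndeg F a := by
    intro a ha
    have : F'.neighborSet a = F.neighborSet a := by
      ext b
      have : ¬ K.Adj a b := fun hab => ha (hKC a b hab)
      change K.Adj a b ∨ (F.Adj a b ∧ _) ↔ F.Adj a b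
      tauto
    rw [ndeg, this]
  refine hmin F' ?_ (fun w => ?_) (fun w hw => ?_)
  · rintro a b (hab | hab)
    · exact hK hab
    · exact h.le hab.1
  · by_cases hc : isoComp G T w = isoComp G T x
    · rw [hin w hc]
      rcases hdeg w hc with h1 | h1 <;> omega
    · rw [hout w hc]; exact h.ndeg_le w
  · by_cases hc : isoComp G T w = isoComp G T x
    · rw [hin w hc]; exact hdeg w hc
    · rw [hout w hc]
      exact h.hnDegree hw (by rintro rfl; exact hc rfl)

end NearFactor

lemma ncard_incident_pairs {V : Type*} [Fintype V] (F : SimpleGraph V) (S : Finset V) :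
    {p : V × V | p.1 ∈ S ∧ F.Adj p.1 p.2}.ncard = ∑ y ∈ S, ndeg F y := by
  classical
  have : {p : V × V | p.1 ∈ S ∧ F.Adj p.1 p.2} =
      ((S.sigma fun y => F.neighborFinset y).map
        (Equiv.sigmaEquivProd V V).toEmbedding : Finset (V × V)) := by
    ext ⟨a, b⟩
    simp
  rw [this, Set.ncard_coe_finset, Finset.card_map, Finset.card_sigma]
  refine Finset.sum_congr rfl fun y _ => ?_
  rw [ndeg, ← Set.ncard_coe_finset, coe_neighborFinset]

/-- `C` is a union of components of `G - S` that has no `Hₙ`-factor. -/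
structure IsCriticalPart {V : Type*} (n : ℕ) (G : SimpleGraph V) (S C : Set V) : Prop where
  disjoint : ∀ a ∈ C, a ∉ S
  closed : ∀ a ∈ C, ∀ b, G.Adj a b → b ∈ S ∨ b ∈ C
  critical : ∀ K ≤ G, (∀ a b, K.Adj a b → a ∈ C) → ¬ ∀ a ∈ C, HnDegree n (ndeg K a)

lemma ncard_le_ncard_notMem_add_one {V : Type*} [Finite V] {R : Set V} {P : V → Set V}
    (hR : R.PairwiseDisjoint P) (w : V) : R.ncard ≤ {r ∈ R | w ∉ P r}.ncard + 1 := by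
  have h1 : {r ∈ R | w ∈ P r}.ncard ≤ 1 := by
    rw [Set.ncard_le_one (Set.toFinite _)]
    rintro a ⟨ha, ha'⟩ b ⟨hb, hb'⟩
    exact hR.elim_set ha hb w ha' hb'
  have h2 : R ⊆ {r ∈ R | w ∉ P r} ∪ {r ∈ R | w ∈ P r} := fun r hr => by
    by_cases h : w ∈ P r
    · exact Or.inr ⟨hr, h⟩
    · exact Or.inl ⟨hr, h⟩
  have h3 := Set.ncard_le_ncard h2 (Set.toFinite _)
  have h4 := Set.ncard_union_le {r ∈ R | w ∉ P r} {r ∈ R | w ∈ P r}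
  omega

lemma exists_isNearFactor {V : Type*} [Finite V] {n : ℕ} {G : SimpleGraph V}
    (hno : ¬ ∃ F, IsHnFactor n G F) :
    ∃ (T W : Set V) (F : SimpleGraph V) (x : V),
      NoSmallerDefect n G W ∧ IsNearFactor n G T W F x := by
  let bad (F : SimpleGraph V) : Set V := {w | ¬ HnDegree n (ndeg F w)}
  obtain ⟨F, ⟨hF, hdeg⟩, hmin⟩ := Set.exists_min_image
    {F : SimpleGraph V | F ≤ G ∧ ∀ w, ndeg F w ≤ 2 * n} (fun F => (bad F).ncard)
    (Set.toFinite _) ⟨⊥, bot_le, fun w => by simp [ndeg]⟩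
  have hx : ∃ x, x ∈ bad F := by
    by_contra! hx
    exact hno ⟨F, hF, fun w => not_not.1 (hx w)⟩
  obtain ⟨x, hx⟩ := hx
  have hbad : ∀ w ∈ bad F, ndeg F w % 2 = 0 ∧ ndeg F w + 2 ≤ 2 * n := fun w hw => by
    have h1 : ¬ HnDegree n (ndeg F w) := hw
    have h2 := hdeg w
    rw [HnDegree, Nat.odd_iff] at h1
    omega
  refine ⟨{w | ndeg F w = 2 * n}, bad F \ {x}, F, x, fun F' hF' hdeg' hW => ?_,
    hF, fun hT => ?_, fun h => h.2 rfl, hbad x hx, fun w hw => hbad w hw.1, fun w hw => hw,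
    fun w hT hW hwx => ?_⟩
  · have h1 := hmin F' ⟨hF', hdeg'⟩
    have h2 : bad F' ⊆ bad F \ {x} := fun w hw => by
      by_contra h
      exact hw (hW w h)
    have h3 := Set.ncard_le_ncard h2 (Set.toFinite _)
    have h4 := Set.ncard_sdiff_singleton_lt_of_mem hx (Set.toFinite _)
    omega
  · exact hx (Or.inr hT)
  · have h1 : HnDegree n (ndeg F w) := by
      by_contra h
      exact hW ⟨h, hwx⟩
    rcases h1 with ⟨h1, h2⟩ | h1
    · rw [Nat.odd_iff] at h1
      omega
    · exact absurd h1 hT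

lemma SimpleGraph.Connected.mem_of_closed {V : Type*} {G : SimpleGraph V} (hG : G.Connected)
    {C : Set V} (hC : ∀ a ∈ C, ∀ b, G.Adj a b → b ∈ C) {a : V} (ha : a ∈ C) (b : V) : b ∈ C := by
  have h := hG.preconnected a b
  rw [reachable_iff_reflTransGen] at h
  induction h with
  | refl => exact ha
  | tail _ hbc ih => exact hC _ ih _ hbc

/-- If all vertices but one have odd degree, the number of vertices is odd. -/
lemma not_even_card_of_odd_degrees {V : Type*} [Fintype V] {F : SimpleGraph V} {x : V}
    (hx : ndeg F x % 2 = 0) (h : ∀ w, w ≠ x → ndeg F w % 2 = 1) : ¬ Even (Fintype.card V) := by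
  classical
  have hdeg : ∀ w, F.degree w = ndeg F w := fun w => by
    rw [← card_neighborFinset_eq_degree, ← Set.ncard_coe_finset, coe_neighborFinset]
  have h1 := F.even_card_odd_degree_vertices
  have h2 : (Finset.univ.filter fun w => Odd (F.degree w)) = Finset.univ.erase x := by
    ext w
    by_cases hw : w = x
    · subst hw; simp [hdeg, Nat.odd_iff, hx]
    · simp [hdeg, Nat.odd_iff, h w hw, hw]
  rw [h2, Finset.card_erase_of_mem (Finset.mem_univ x), Finset.card_univ] at h1
  have h3 : 0 < Fintype.card V := Fintype.card_pos_iff.2 ⟨x⟩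
  rw [Nat.even_iff] at h1 ⊢
  omega

/-- The structure theorem: a connected graph of even order without an `Hₙ`-factor has a nonempty
set `S` of vertices such that `G - S` has more than `2 * n * |S|` components, represented by the
vertices of `R`, without an `Hₙ`-factor. -/
theorem exists_isCriticalPart {V : Type*} [Fintype V] {n : ℕ} {G : SimpleGraph V}
    (hG : G.Connected) (heven : Even (Fintype.card V)) (hno : ¬ ∃ F, IsHnFactor n G F) :
    ∃ (S : Finset V) (R : Set V) (P : V → Set V), S.Nonempty ∧ R.ncard = 2 * n * S.card + 1 ∧
      R.PairwiseDisjoint P ∧ ∀ r ∈ R, r ∈ P r ∧ IsCriticalPart n G S (P r) := by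
  classical
  obtain ⟨T, W, F, x, hmin, hF⟩ := exists_isNearFactor hno
  set D := defectSet G T (F, x) with hD
  have hnear : ∀ a ∈ D, ∃ F', Relation.ReflTransGen (DefectStep G T) (F, x) (F', a) ∧
      IsNearFactor n G T W F' a := fun a ⟨F', h⟩ => ⟨F', h, hF.steps (s := (F, x)) hmin h⟩
  have hDT : ∀ a ∈ D, a ∉ T := fun a ha => by
    obtain ⟨F', -, h⟩ := hnear a ha
    exact h.notMem_T
  have hxD : x ∈ D := ⟨F, .refl⟩
  let S : Finset V := Finset.univ.filter fun y => y ∈ T ∧ ∃ a ∈ D, G.Adj a y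
  have hS : ∀ y, y ∈ S ↔ y ∈ T ∧ ∃ a ∈ D, G.Adj a y := fun y => by simp [S]
  have hclosed : ∀ a ∈ D, ∀ b, G.Adj a b → b ∈ S ∨ isoComp G T b = isoComp G T a := by
    intro a ha b hab
    by_cases hb : b ∈ T
    · exact Or.inl ((hS b).2 ⟨hb, a, ha, hab⟩)
    · exact Or.inr (isoComp_eq_of_adj hab (hDT a ha) hb).symm
  have hSD : ∀ y ∈ S, ∀ z, F.Adj y z → z ∈ D := by
    intro y hy z hyz
    obtain ⟨hyT, a, ha, hay⟩ := (hS y).1 hy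
    obtain ⟨F', hF', -⟩ := hnear a ha
    by_contra hz
    have hyD : y ∉ D := fun h => hDT y h hyT
    have h1 : F'.Adj y z := (adj_iff_of_notMem_defectSet hF' hyD hz).2 hyz
    exact hz ⟨toggle (toggle F' a y) y z, hF'.tail (Or.inr ⟨y, hyT, hay, h1, rfl⟩)⟩
  have hcomp : ∀ a ∈ D, ∀ b, isoComp G T b = isoComp G T a → b ∈ D := fun a ha b hb =>
    mem_defectSet_of_isoComp_eq ha (hDT a ha) hb.symm
  have hne : S.Nonempty := by
    by_contra hne
    rw [Finset.not_nonempty_iff_eq_empty] at hne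
    have hall : ∀ b, b ∈ D := hG.mem_of_closed (fun a ha b hab => by
      rcases hclosed a ha b hab with h | h
      · simp [hne] at h
      · exact hcomp a ha b h) hxD
    refine not_even_card_of_odd_degrees hF.defect.1 (fun w hw => ?_) heven
    obtain ⟨F', -, h⟩ := hnear w (hall w)
    exact (hF.of_notMem w h.notMem_T h.notMem_W hw).1
  let E : Set (V × V) := {p | p.1 ∈ S ∧ F.Adj p.1 p.2}
  have hE : E.ncard = 2 * n * S.card := by
    rw [ncard_incident_pairs, Finset.sum_congr rfl fun y hy => hF.of_mem_T y ((hS y).1 hy).1]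
    simp [mul_comm]
  have hsep : ∀ z ∈ D, AlmostSeparated G T (isoComp G T z) (F, x) := fun z hz =>
    .of_mem_defectSet hmin hF hz
  have hEinj : ∀ p ∈ E, ∀ q ∈ E, isoComp G T p.2 = isoComp G T q.2 → p = q := by
    rintro ⟨y, z⟩ ⟨hy, hyz⟩ ⟨y', z'⟩ ⟨hy', hyz'⟩ h
    obtain ⟨rfl, rfl⟩ := (hsep z (hSD y hy z hyz)).1 y ((hS y).1 hy).1 y' ((hS y').1 hy').1
      z z' rfl h.symm hyz hyz'
    rfl
  have hEx : ∀ p ∈ E, isoComp G T p.2 ≠ isoComp G T x := by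
    rintro ⟨y, z⟩ ⟨hy, hyz⟩ h
    exact (hsep x hxD).2 rfl y ((hS y).1 hy).1 z h hyz
  have hRD : ∀ r ∈ insert x (Prod.snd '' E), r ∈ D := by
    rintro r (rfl | ⟨p, hp, rfl⟩)
    · exact hxD
    · exact hSD p.1 hp.1 p.2 hp.2
  refine ⟨S, insert x (Prod.snd '' E), fun r => {a | isoComp G T a = isoComp G T r}, hne,
    ?_, ?_, fun r hr => ⟨rfl, fun a ha haS => ?_, fun a ha b hab => ?_, fun K hK hKC hdeg => ?_⟩⟩
  · rw [Set.ncard_insert_of_notMem _ (Set.toFinite _), Set.InjOn.ncard_image, hE]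
    · intro p hp q hq h
      exact hEinj p hp q hq (congrArg (isoComp G T) h)
    · rintro ⟨p, hp, h⟩
      exact hEx p hp (congrArg (isoComp G T) h)
  · intro r hr r' hr' hrr'
    refine Set.disjoint_left.2 fun a ha ha' => hrr' ?_
    have h : isoComp G T r = isoComp G T r' := Eq.trans (Eq.symm ha) ha'
    rcases hr with rfl | ⟨p, hp, rfl⟩ <;> rcases hr' with rfl | ⟨q, hq, rfl⟩
    · rfl
    · exact absurd h.symm (hEx q hq)
    · exact absurd h (hEx p hp)
    · rw [hEinj p hp q hq h]
  · exact hDT a (hcomp r (hRD r hr) a ha) ((hS a).1 haS).1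
  · exact (hclosed a (hcomp r (hRD r hr) a ha) b hab).imp_right fun h => h.trans ha
  · obtain ⟨F', -, h⟩ := hnear r (hRD r hr)
    exact h.isoComp_critical hmin hK hKC hdeg

section AddEdge

variable {V : Type*} {n : ℕ} {G F : SimpleGraph V} {S : Finset V} {R : Set V} {P : V → Set V}
  {u v : V}

lemma adj_of_adj_sup_edge (hF : F ≤ G ⊔ SimpleGraph.fromEdgeSet {s(u, v)}) {a b : V}
    (h : F.Adj a b) : G.Adj a b ∨ s(a, b) = s(u, v) := by
  rcases hF h with h | h
  · exact Or.inl h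
  · exact Or.inr (by simpa using h.1)

lemma adj_of_not_exists_isHnFactor (hno : ¬ ∃ F, IsHnFactor n G F)
    (hF : IsHnFactor n (G ⊔ SimpleGraph.fromEdgeSet {s(u, v)}) F) : F.Adj u v := by
  by_contra huv
  refine hno ⟨F, fun a b hab => ?_, hF.2⟩
  rcases adj_of_adj_sup_edge hF.1 hab with h | h
  · exact h
  · rw [← SimpleGraph.mem_edgeSet, h] at hab
    exact absurd hab huv

/-- An end of the new edge cannot lie in the separating set of the structure theorem. -/
lemma notMem_of_isHnFactor_sup_edge [Fintype V] (hno : ¬ ∃ F, IsHnFactor n G F)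
    (hF : IsHnFactor n (G ⊔ SimpleGraph.fromEdgeSet {s(u, v)}) F)
    (hcard : R.ncard = 2 * n * S.card + 1) (hdisj : R.PairwiseDisjoint P)
    (hP : ∀ r ∈ R, r ∈ P r ∧ IsCriticalPart n G S (P r)) : u ∉ S := by
  intro hu
  have huv := adj_of_not_exists_isHnFactor hno hF
  have hex : ∀ r ∈ {r ∈ R | v ∉ P r}, ∃ p : V × V, p.1 ∈ S ∧ p.2 ∈ P r ∧ F.Adj p.1 p.2 := by
    rintro r ⟨hr, hv⟩
    obtain ⟨-, hC⟩ := hP r hr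
    by_contra! hnone
    have hu' : u ∉ P r := fun h => hC.disjoint u h hu
    have hadj : ∀ a ∈ P r, ∀ b, F.Adj a b → G.Adj a b := fun a ha b hab => by
      rcases adj_of_adj_sup_edge hF.1 hab with h | h
      · exact h
      · rw [Sym2.eq_iff] at h
        grind
    have hclosed : ∀ a ∈ P r, ∀ b, F.Adj a b → b ∈ P r := fun a ha b hab =>
      (hC.closed a ha b (hadj a ha b hab)).resolve_left fun hb => hnone (b, a) hb ha hab.symm
    let K : SimpleGraph V :=
      { Adj := fun a b => F.Adj a b ∧ a ∈ P r
        symm := ⟨fun a b h => ⟨h.1.symm, hclosed a h.2 b h.1⟩⟩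
        loopless := ⟨fun a h => h.1.ne rfl⟩ }
    refine hC.critical K (fun a b h => hadj a h.2 b h.1) (fun a b h => h.2) fun a ha => ?_
    have : K.neighborSet a = F.neighborSet a := by
      ext b
      exact and_iff_left ha
    rw [ndeg, this]
    exact hF.2 a
  choose! f hfS hfP hfadj using hex
  have h1 : insert (u, v) (f '' {r ∈ R | v ∉ P r}) ⊆ {p : V × V | p.1 ∈ S ∧ F.Adj p.1 p.2} := by
    rintro p (rfl | ⟨r, hr, rfl⟩)
    · exact ⟨hu, huv⟩
    · exact ⟨hfS r hr, hfadj r hr⟩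
  have h2 := Set.ncard_le_ncard h1 (Set.toFinite _)
  rw [Set.ncard_insert_of_notMem _ (Set.toFinite _), Set.InjOn.ncard_image,
    ncard_incident_pairs] at h2
  · have h3 : ∑ y ∈ S, ndeg F y ≤ S.card * (2 * n) := by
      refine Finset.sum_le_card_nsmul _ _ _ fun y _ => ?_
      rcases hF.2 y with h | h <;> simp only [ndeg] <;> omega
    have h4 := ncard_le_ncard_notMem_add_one hdisj v
    rw [hcard] at h4
    rw [mul_comm] at h3
    omega
  · intro r hr r' hr' h
    exact hdisj.elim_set hr.1 hr'.1 _ (hfP r hr) (h ▸ hfP r' hr')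
  · rintro ⟨r, hr, h⟩
    have := hfP r hr
    rw [h] at this
    exact hr.2 this

end AddEdge

theorem stmt_7 {V : Type*} [Fintype V] (n k : ℕ) (hn : 1 ≤ n) (hk : 1 ≤ k)
    (G : SimpleGraph V) (hconn : KConnected k G) (heven : Even (Fintype.card V))
    (u v : V) (hne : u ≠ v) (hadj : ¬ G.Adj u v)
    (hN : ((Fintype.card V : ℤ) - 2 * n * k) ≤
      ((G.neighborSet u ∪ G.neighborSet v).ncard : ℤ))
    (h : ∃ F, IsHnFactor n (G ⊔ SimpleGraph.fromEdgeSet {s(u, v)}) F) :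
    ∃ F, IsHnFactor n G F := by
  by_contra hno
  obtain ⟨F, hF⟩ := h
  have hG : G.Connected := by
    have h1 := hconn.2 ∅ (by rwa [Set.ncard_empty])
    rw [Set.compl_empty] at h1
    exact (SimpleGraph.induceUnivIso G).connected_iff.1 h1
  obtain ⟨S, R, P, hSne, hcard, hdisj, hP⟩ := exists_isCriticalPart hG heven hno
  have hu := notMem_of_isHnFactor_sup_edge hno hF hcard hdisj hP
  have hv := notMem_of_isHnFactor_sup_edge hno (Sym2.eq_swap (a := u) (b := v) ▸ hF) hcard hdisj hP
  by_cases hSk : S.card < k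
  · have h1 := hconn.2 S (by rwa [Set.ncard_coe_finset])
    have h2 : 1 < R.ncard := by
      have := Nat.mul_pos (Nat.mul_pos two_pos hn) hSne.card_pos
      omega
    obtain ⟨r, hr, r', hr', hrr'⟩ := (Set.one_lt_ncard (Set.toFinite _)).1 h2
    obtain ⟨hrP, hC⟩ := hP r hr
    obtain ⟨hrP', hC'⟩ := hP r' hr'
    have h3 := h1.mem_of_closed (C := {a | (a : V) ∈ P r})
      (fun a ha b hab => (hC.closed a ha b hab).resolve_left b.2)
      (a := ⟨r, hC.disjoint r hrP⟩) hrP ⟨r', hC'.disjoint r' hrP'⟩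
    exact hrr' (hdisj.elim_set hr hr' r' h3 hrP')
  · have h1 := ncard_le_ncard_notMem_add_one hdisj u
    have h2 := ncard_le_ncard_notMem_add_one
      (hdisj.subset (Set.sep_subset R fun r => u ∉ P r)) v
    set M : Set V := {r ∈ {r ∈ R | u ∉ P r} | v ∉ P r} with hM
    have hsub : insert u (insert v M) ⊆ (G.neighborSet u ∪ G.neighborSet v)ᶜ := by
      rintro w (rfl | rfl | ⟨⟨hw, hwu⟩, hwv⟩) (hw' | hw')
      · exact G.irrefl hw'
      · exact hadj hw'.symm
      · exact hadj hw'
      · exact G.irrefl hw'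
      · exact ((hP w hw).2.closed w (hP w hw).1 u hw'.symm).elim hu hwu
      · exact ((hP w hw).2.closed w (hP w hw).1 v hw'.symm).elim hv hwv
    have h3 := Set.ncard_le_ncard hsub (Set.toFinite _)
    have h4 : v ∉ M := fun h => h.2 (hP v h.1.1).1
    have h5 : u ∉ insert v M := by
      rintro (h | h)
      · exact hne h
      · exact h.1.2 (hP u h.1.1).1
    rw [Set.ncard_insert_of_notMem h5 (Set.toFinite _),
      Set.ncard_insert_of_notMem h4 (Set.toFinite _)] at h3
    have h6 := Set.ncard_add_ncard_compl (G.neighborSet u ∪ G.neighborSet v)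
    rw [Nat.card_eq_fintype_card] at h6
    have h7 : 2 * n * k ≤ 2 * n * S.card := Nat.mul_le_mul_left _ (not_lt.1 hSk)
    zify at h1 h2 h3 h6 h7 hcard
    linarith
end

section
/- Let G be a graph on g vertices with no odd components. Suppose that for every pair of non-adjacent vertices u, v we have |N_G(u) ∪ N_G(v)| > max{(g−2)/(2n) − 1, (2g−4)/(4n+1), (g−1)/(2n+1), 4n−3}. Then G contains an H_n-factor. -/
open SimpleGraph

section

open Finset

/-- A family of pairwise disjoint vertex sets avoiding `T`, each of odd `f`-weight and with no
edges leaving it except to `T`. -/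
structure IsOddFamily {V : Type*} (G : SimpleGraph V) (f : V → ℕ) (T : Finset V)
    (𝒟 : Finset (Finset V)) : Prop where
  disj : ∀ D ∈ 𝒟, ∀ E ∈ 𝒟, ∀ x, x ∈ D → x ∈ E → D = E
  avoid : ∀ D ∈ 𝒟, ∀ x ∈ D, x ∉ T
  closed : ∀ D ∈ 𝒟, ∀ x ∈ D, ∀ y, G.Adj x y → y ∈ T ∨ y ∈ D
  odd : ∀ D ∈ 𝒟, Odd (∑ v ∈ D, f v)

theorem exists_involution_or_isOddFamily {β : Type*} [Fintype β] [DecidableEq β]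
    (B : SimpleGraph β) :
    (∃ p : β → β, Function.Involutive p ∧ ∀ x, B.Adj x (p x)) ∨
      ∃ U 𝒦, IsOddFamily B (fun _ => 1) U 𝒦 ∧ #U < #𝒦 := by
  classical
  by_cases h : ∃ M : Subgraph B, M.IsPerfectMatching
  · left
    obtain ⟨M, hM⟩ := h
    rw [Subgraph.isPerfectMatching_iff] at hM
    choose p hp hp' using hM
    exact ⟨p, fun x => (hp' _ _ (hp x).symm).symm, fun x => (hp x).adj_sub⟩
  · right
    rw [tutte] at h
    push Not at h
    obtain ⟨u, hu⟩ := h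
    unfold IsTutteViolator at hu
    set H := ((⊤ : B.Subgraph).deleteVerts u).coe with hH
    have hmem : ∀ x, x ∉ u → x ∈ ((⊤ : B.Subgraph).deleteVerts u).verts := by
      intro x hx; simp [hx]
    let S : H.ConnectedComponent → Finset β :=
      fun K => {x | ∃ hx : x ∉ u, H.connectedComponentMk ⟨x, hmem x hx⟩ = K}
    have hS : ∀ K x, x ∈ S K ↔ ∃ hx : x ∉ u, H.connectedComponentMk ⟨x, hmem x hx⟩ = K := by
      intro K x; simp [S]
    have hcard : ∀ K, #(S K) = K.supp.ncard := by
      intro K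
      rw [← Set.ncard_image_of_injective K.supp Subtype.val_injective, ← Set.ncard_coe_finset]
      congr 1
      ext x
      simp only [mem_coe, hS, Set.mem_image, ConnectedComponent.mem_supp_iff]
      constructor
      · rintro ⟨hx, h⟩
        exact ⟨_, h, rfl⟩
      · rintro ⟨⟨y, hy⟩, h, rfl⟩
        exact ⟨by simpa using hy, h⟩
    have hinj : Function.Injective S := by
      intro K K' hKK
      obtain ⟨⟨y, hy⟩, rfl⟩ := K.exists_rep
      have : y ∈ S K' := by
        rw [← hKK]
        exact (hS _ _).2 ⟨by simpa using hy, rfl⟩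
      rw [hS] at this
      exact this.2
    refine ⟨u.toFinset, H.oddComponents.toFinset.image S, ⟨?_, ?_, ?_, ?_⟩, ?_⟩
    · simp only [mem_image]
      rintro _ ⟨K, -, rfl⟩ _ ⟨K', -, rfl⟩ x hx hx'
      rw [hS] at hx hx'
      rw [← hx.2, ← hx'.2]
    · simp only [mem_image]
      rintro _ ⟨K, -, rfl⟩ x hx
      rw [hS] at hx
      simpa using hx.1
    · simp only [mem_image]
      rintro _ ⟨K, -, rfl⟩ x hx y hxy
      rw [hS] at hx
      obtain ⟨hxu, rfl⟩ := hx
      by_cases hy : y ∈ u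
      · left; simpa using hy
      · right
        rw [hS]
        refine ⟨hy, ConnectedComponent.sound (Adj.reachable ?_)⟩
        simp [hH, hxu, hy, hxy.symm]
    · simp only [mem_image]
      rintro _ ⟨K, hK, rfl⟩
      simpa [hcard] using hK
    · rw [card_image_of_injective _ hinj, ← Set.ncard_eq_toFinset_card',
        ← Set.ncard_eq_toFinset_card']
      exact hu

/-- The graph obtained from `G` by replacing each vertex `v` by a clique on `f v` vertices. -/
def cliqueBlowup {V : Type*} (G : SimpleGraph V) (f : V → ℕ) :
    SimpleGraph (Σ v, Fin (f v)) where
  Adj x y := (x.1 = y.1 ∧ x ≠ y) ∨ G.Adj x.1 y.1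
  symm := ⟨fun x y h => h.imp (fun h => ⟨h.1.symm, h.2.symm⟩) (fun h => h.symm)⟩
  loopless := ⟨fun x h => by simp at h⟩

theorem even_card_of_involution {β : Type*} [DecidableEq β] (s : Finset β) (p : β → β)
    (hp : Function.Involutive p) (hs : ∀ x ∈ s, p x ∈ s) (hne : ∀ x, p x ≠ x) : Even #s := by
  have : ∑ x ∈ s, (1 : ZMod 2) = 0 :=
    sum_involution (fun x _ => p x) (fun _ _ => by decide) (fun x _ _ => hne x) hs
      (fun x _ => hp x)
  rw [sum_const, nsmul_eq_mul, mul_one] at this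
  exact ZMod.natCast_eq_zero_iff_even.1 this

theorem exists_parity_subgraph_of_involution {V : Type*} [Fintype V] [DecidableEq V]
    (G : SimpleGraph V) (f : V → ℕ) (p : (Σ v, Fin (f v)) → Σ v, Fin (f v))
    (hp : Function.Involutive p) (hadj : ∀ x, (cliqueBlowup G f).Adj x (p x)) :
    ∃ F ≤ G, ∀ v, (F.neighborSet v).ncard ≤ f v ∧ (F.neighborSet v).ncard % 2 = f v % 2 := by
  classical
  let m : V → V → ℕ := fun v u => #{x : Σ v, Fin (f v) | x.1 = v ∧ (p x).1 = u}
  have hsymm : ∀ u v, m u v = m v u := by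
    intro u v
    refine card_bij' (fun x _ => p x) (fun x _ => p x) ?_ ?_ ?_ ?_
    · intro x; simp +contextual [hp x]
    · intro x; simp +contextual [hp x]
    · intro x _; exact hp x
    · intro x _; exact hp x
  have hsum : ∀ v, ∑ u, m v u = f v := by
    intro v
    have h1 : #{x : Σ v, Fin (f v) | x.1 = v} = f v := by
      rw [← Fintype.card_fin (f v), ← Finset.card_univ]
      symm
      refine card_bij (fun i _ => (⟨v, i⟩ : Σ v, Fin (f v))) ?_ ?_ ?_
      · simp
      · intro i _ j _ h; simpa using h
      · rintro ⟨w, i⟩ h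
        simp only [mem_filter, mem_univ, true_and] at h
        subst h
        exact ⟨i, mem_univ _, rfl⟩
    rw [← h1, card_eq_sum_card_fiberwise (f := fun x => (p x).1) (t := univ) (by simp)]
    refine sum_congr rfl fun u _ => ?_
    rw [filter_filter]
  have hdiag : ∀ v, Even (m v v) := by
    intro v
    refine even_card_of_involution _ p hp ?_ (fun x => (hadj x).ne')
    intro x; simp +contextual [hp x]
  have hG : ∀ v u, v ≠ u → m v u ≠ 0 → G.Adj v u := by
    intro v u hvu hm
    obtain ⟨x, hx⟩ := card_pos.1 (Nat.pos_of_ne_zero hm)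
    simp only [mem_filter, mem_univ, true_and] at hx
    obtain ⟨rfl, rfl⟩ := hx
    exact (hadj x).resolve_left fun h => hvu h.1
  let F : SimpleGraph V :=
    { Adj := fun u v => Odd (m u v)
      symm := ⟨fun u v h => by rwa [hsymm]⟩
      loopless := ⟨fun u h => (Nat.not_odd_iff_even.2 (hdiag u)) h⟩ }
  refine ⟨F, fun u v (h : F.Adj u v) => hG u v h.ne ?_, fun v => ?_⟩
  · have h' : Odd (m u v) := h
    exact h'.pos.ne'
  · have hN : (F.neighborSet v).ncard = #{u | Odd (m v u)} := by
      rw [← Set.ncard_coe_finset]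
      congr 1
      ext u
      simp [F]
    rw [hN]
    constructor
    · rw [← hsum v, card_eq_sum_ones, sum_filter]
      refine sum_le_sum fun u _ => ?_
      split_ifs with h
      · exact h.pos
      · exact Nat.zero_le _
    · have := odd_sum_iff_odd_card_odd (s := univ) (fun u => m v u)
      rw [hsum] at this
      grind

theorem exists_parity_subgraph {V : Type*} [Fintype V] [DecidableEq V]
    (G : SimpleGraph V) (f : V → ℕ)
    (h : ∀ T 𝒟, (∀ v, f v = 0 → v ∈ T) → IsOddFamily G f T 𝒟 → #𝒟 ≤ ∑ v ∈ T, f v) :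
    ∃ F ≤ G, ∀ v, (F.neighborSet v).ncard ≤ f v ∧ (F.neighborSet v).ncard % 2 = f v % 2 := by
  classical
  obtain ⟨p, hp, hadj⟩ | ⟨U, 𝒦, h𝒦, hlt⟩ := exists_involution_or_isOddFamily (cliqueBlowup G f)
  · exact exists_parity_subgraph_of_involution G f p hp hadj
  exfalso
  have hsigma : ∀ D : Finset V, #{x : Σ v, Fin (f v) | x.1 ∈ D} = ∑ v ∈ D, f v := by
    intro D
    have : (univ.filter fun x : Σ v, Fin (f v) => x.1 ∈ D) = D.sigma fun v => univ := by
      ext x; simp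
    rw [this, card_sigma]
    simp
  let T : Finset V := {v | ∀ i : Fin (f v), (⟨v, i⟩ : Σ v, Fin (f v)) ∈ U}
  have hT : ∀ v, v ∉ T ↔ ∃ i : Fin (f v), (⟨v, i⟩ : Σ v, Fin (f v)) ∉ U := by
    intro v; simp [T]
  let φ : Finset (Σ v, Fin (f v)) → Finset V := fun K => K.image Sigma.fst
  have hfib : ∀ K ∈ 𝒦, ∀ x ∈ K, ∀ y, y ∉ U → y.1 = x.1 → y ∈ K := by
    intro K hK x hx y hy hxy
    by_cases hne : x = y
    · exact hne ▸ hx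
    · exact (h𝒦.closed K hK x hx y (Or.inl ⟨hxy.symm, hne⟩)).resolve_left hy
  have hsplit : ∀ K ∈ 𝒦, ∑ v ∈ φ K, f v = #K + #{x ∈ U | x.1 ∈ φ K} := by
    intro K hK
    rw [← hsigma, ← card_union_of_disjoint]
    · congr 1
      ext x
      simp only [mem_filter, mem_univ, true_and, mem_union, φ, mem_image]
      constructor
      · rintro ⟨y, hy, hyx⟩
        by_cases hx : x ∈ U
        · exact Or.inr ⟨hx, y, hy, hyx⟩
        · exact Or.inl (hfib K hK y hy x hx hyx.symm)
      · rintro (hx | ⟨-, hx⟩)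
        · exact ⟨x, hx, rfl⟩
        · exact hx
    · rw [Finset.disjoint_left]
      intro x hx hx'
      exact h𝒦.avoid K hK x hx (mem_filter.1 hx').1
  have hφdisj : ∀ K ∈ 𝒦, ∀ K' ∈ 𝒦, ∀ v, v ∈ φ K → v ∈ φ K' → K = K' := by
    intro K hK K' hK' v hv hv'
    simp only [φ, mem_image] at hv hv'
    obtain ⟨x, hx, rfl⟩ := hv
    obtain ⟨y, hy, hyx⟩ := hv'
    exact h𝒦.disj K hK K' hK' x hx (hfib K' hK' y hy x (h𝒦.avoid K hK x hx) hyx.symm)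
  have hφT : ∀ K ∈ 𝒦, ∀ v ∈ φ K, v ∉ T := by
    intro K hK v hv
    simp only [φ, mem_image] at hv
    obtain ⟨x, hx, rfl⟩ := hv
    rw [hT]
    exact ⟨x.2, h𝒦.avoid K hK x hx⟩
  have hKodd : ∀ K ∈ 𝒦, Odd #K := fun K hK => by simpa using h𝒦.odd K hK
  set 𝒜 := 𝒦.filter fun K => Odd (∑ v ∈ φ K, f v) with h𝒜
  set ℬ := 𝒦.filter fun K => ¬ Odd (∑ v ∈ φ K, f v) with hℬ
  have h𝒜ℬ : #𝒜 + #ℬ = #𝒦 := card_filter_add_card_filter_not _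
  have hφinj : Set.InjOn φ 𝒜 := by
    intro K hK K' hK' hKK
    simp only [h𝒜, mem_coe, mem_filter] at hK hK'
    obtain ⟨x, hx⟩ := card_pos.1 (hKodd K hK.1).pos
    exact hφdisj K hK.1 K' hK'.1 x.1 (mem_image_of_mem _ hx) (hKK ▸ mem_image_of_mem _ hx)
  have hfam : IsOddFamily G f T (𝒜.image φ) := by
    refine ⟨?_, ?_, ?_, ?_⟩
    · simp only [mem_image, h𝒜, mem_filter]
      rintro _ ⟨K, hK, rfl⟩ _ ⟨K', hK', rfl⟩ v hv hv'
      rw [hφdisj K hK.1 K' hK'.1 v hv hv']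
    · simp only [mem_image, h𝒜, mem_filter]
      rintro _ ⟨K, hK, rfl⟩ v hv
      exact hφT K hK.1 v hv
    · simp only [mem_image, h𝒜, mem_filter]
      rintro _ ⟨K, hK, rfl⟩ v hv w hvw
      by_cases hw : w ∈ T
      · exact Or.inl hw
      · right
        obtain ⟨i, hi⟩ := (hT w).1 hw
        simp only [φ, mem_image] at hv ⊢
        obtain ⟨x, hx, rfl⟩ := hv
        exact ⟨⟨w, i⟩, (h𝒦.closed K hK.1 x hx ⟨w, i⟩ (Or.inr hvw)).resolve_left hi, rfl⟩
    · simp only [mem_image, h𝒜, mem_filter]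
      rintro _ ⟨K, hK, rfl⟩
      exact hK.2
  have h1 := h T _ (fun v hv => by
    simp only [T, mem_filter, mem_univ, true_and]
    exact fun i => absurd i.2 (by omega)) hfam
  rw [card_image_of_injOn hφinj] at h1
  have h2 : #ℬ + ∑ v ∈ T, f v ≤ #U := by
    have hTU : ∑ v ∈ T, f v = #{x ∈ U | x.1 ∈ T} := by
      rw [← hsigma]
      congr 1
      ext x
      simp only [mem_filter, mem_univ, true_and, T]
      exact ⟨fun hx => ⟨hx x.2, hx⟩, fun hx => hx.2⟩
    have hex : ∀ K : ℬ, ∃ x ∈ U, x.1 ∈ φ K := by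
      rintro ⟨K, hK⟩
      simp only [hℬ, mem_filter] at hK
      have := hsplit K hK.1
      have hodd := hKodd K hK.1
      obtain ⟨x, hx⟩ : ({x ∈ U | x.1 ∈ φ K}).Nonempty := by
        rw [← card_pos]
        by_contra hcon
        exact hK.2 (by rw [this]; simpa [Nat.eq_zero_of_not_pos hcon] using hodd)
      exact ⟨x, (mem_filter.1 hx).1, (mem_filter.1 hx).2⟩
    choose g hgU hgφ using hex
    have hg : #ℬ ≤ #{x ∈ U | x.1 ∉ T} := by
      rw [← Fintype.card_coe ℬ, ← card_univ]
      refine card_le_card_of_injOn g ?_ ?_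
      · intro K _
        exact mem_coe.2 (mem_filter.2 ⟨hgU K, hφT K (mem_filter.1 K.2).1 _ (hgφ K)⟩)
      · intro K _ K' _ hKK
        refine Subtype.ext (hφdisj K (mem_filter.1 K.2).1 K' (mem_filter.1 K'.2).1 (g K).1
          (hgφ K) ?_)
        rw [hKK]; exact hgφ K'
    rw [hTU, ← card_filter_add_card_filter_not (s := U) (fun x => x.1 ∈ T)]
    omega
  omega

theorem exists_parity_subgraph_on {V : Type*} [Fintype V] [DecidableEq V]
    (G : SimpleGraph V) (f : V → ℕ) (W : Finset V)
    (h : ∀ T ⊆ W, ∀ 𝒟, IsOddFamily G f (T ∪ Wᶜ) 𝒟 → #𝒟 ≤ ∑ v ∈ T, f v) :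
    ∃ F ≤ G, (∀ u v, F.Adj u v → u ∈ W) ∧
      ∀ v ∈ W, (F.neighborSet v).ncard ≤ f v ∧ (F.neighborSet v).ncard % 2 = f v % 2 := by
  have key : ∀ T 𝒟, (∀ v, (if v ∈ W then f v else 0) = 0 → v ∈ T) →
      IsOddFamily G (fun v => if v ∈ W then f v else 0) T 𝒟 →
      #𝒟 ≤ ∑ v ∈ T, if v ∈ W then f v else 0 := by
    intro T 𝒟 hT h𝒟
    have hTW : T ∩ W ∪ Wᶜ = T := by
      ext v
      have := hT v
      simp only [mem_union, mem_inter, mem_compl]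
      grind
    rw [← sum_filter, filter_mem_eq_inter]
    refine h (T ∩ W) inter_subset_right 𝒟 ⟨h𝒟.disj, by rw [hTW]; exact h𝒟.avoid,
      by rw [hTW]; exact h𝒟.closed, fun D hD => ?_⟩
    have h1 := h𝒟.odd D hD
    rwa [sum_congr rfl fun v hv => if_pos ?_] at h1
    by_contra hvW
    exact h𝒟.avoid D hD v hv (hT v (by simp [hvW]))
  obtain ⟨F, hF, hdeg⟩ := exists_parity_subgraph G _ key
  refine ⟨F, hF, fun u v huv => ?_, fun v hv => by simpa [hv] using hdeg v⟩
  by_contra hu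
  have := (hdeg u).1
  simp only [hu, if_false, Nat.le_zero, Set.ncard_eq_zero (Set.toFinite _)] at this
  exact (this ▸ (show v ∈ F.neighborSet u from huv) : v ∈ (∅ : Set V))

/-- A Mendelsohn–Dulmage type assignment: every `a` can be given `k` partners, and the elements
of `N` can be covered with `k + 1` places for each `a`; then both can be done at once. -/
theorem exists_assignment {α β : Type*} [Fintype α] [Fintype β] [DecidableEq α] [DecidableEq β]
    (r : α → β → Prop) [∀ a b, Decidable (r a b)] (N : Finset β) (k : ℕ)
    (h₁ : ∀ A : Finset α, k * #A ≤ #{b | ∃ a ∈ A, r a b})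
    (h₂ : ∀ B ⊆ N, #B ≤ (k + 1) * #{a | ∃ b ∈ B, r a b}) :
    ∃ w : β → Option α, (∀ b a, w b = some a → r a b) ∧ (∀ b ∈ N, w b ≠ none) ∧
      ∀ a, #{b | w b = some a} = k ∨ #{b | w b = some a} = k + 1 := by
  classical
  let t : (α × Fin (k + 1)) ⊕ β → Finset (β ⊕ (α × Fin (k + 1))) := fun x => match x with
    | .inl z => univ.filter fun y => match y with
      | .inl b => r z.1 b
      | .inr _ => z.2 = Fin.last k
    | .inr _ => univ.filter fun y => match y with
      | .inl b => b ∉ N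
      | .inr _ => True
  have ht₁ : ∀ z b, .inl b ∈ t (.inl z) ↔ r z.1 b := by intro z b; simp [t]
  have ht₂ : ∀ z z', .inr z' ∈ t (.inl z) ↔ z.2 = Fin.last k := by intro z b; simp [t]
  have ht₃ : ∀ b' b, .inl b ∈ t (.inr b') ↔ b ∉ N := by intro z b; simp [t]
  have ht₄ : ∀ b' z, .inr z ∈ t (.inr b') := by intro z b; simp [t]
  have hall : ∀ A : Finset ((α × Fin (k + 1)) ⊕ β), #A ≤ #(A.biUnion t) := by
    intro A
    have hA : #A = #A.toLeft + #A.toRight := (card_toLeft_add_card_toRight).symm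
    have hA' : #(A.biUnion t) = #(A.biUnion t).toLeft + #(A.biUnion t).toRight :=
      (card_toLeft_add_card_toRight).symm
    have hcardZ : #(univ : Finset (α × Fin (k + 1))) = (k + 1) * Fintype.card α := by
      simp [mul_comm]
    have hle : #A.toLeft ≤ #(univ : Finset (α × Fin (k + 1))) := card_le_card (subset_univ _)
    set π := A.toLeft.image Prod.fst with hπ
    have hprod : #A.toLeft ≤ (k + 1) * #π := by
      have : A.toLeft ⊆ π ×ˢ (univ : Finset (Fin (k + 1))) := by
        intro z hz
        simp only [mem_product, mem_univ, and_true]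
        exact mem_image_of_mem _ hz
      simpa [mul_comm] using card_le_card this
    by_cases hR : A.toRight.Nonempty
    · obtain ⟨b₀, hb₀⟩ := hR
      rw [mem_toRight] at hb₀
      have e₁ : (A.biUnion t).toRight = univ := by
        ext z
        simp only [mem_toRight, mem_biUnion, mem_univ, iff_true]
        exact ⟨_, hb₀, ht₄ b₀ _⟩
      set B := N.filter fun b => ∀ a ∈ π, ¬ r a b with hB
      have e₂ : Bᶜ ⊆ (A.biUnion t).toLeft := by
        intro b hb
        simp only [mem_toLeft, mem_biUnion]
        by_cases hbN : b ∈ N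
        · simp only [hB, mem_compl, mem_filter, hbN, true_and] at hb
          push Not at hb
          obtain ⟨a, ha, hab⟩ := hb
          obtain ⟨z, hz, rfl⟩ := mem_image.1 ha
          exact ⟨_, mem_toLeft.1 hz, (ht₁ _ _).2 hab⟩
        · exact ⟨_, hb₀, (ht₃ b₀ _).2 hbN⟩
      have e₃ := h₂ B (filter_subset _ _)
      have e₄ : #{a | ∃ b ∈ B, r a b} + #π ≤ Fintype.card α := by
        rw [← card_union_of_disjoint]
        · exact card_le_univ _
        · rw [Finset.disjoint_left]
          intro a ha haπ
          simp only [mem_filter, mem_univ, true_and, hB] at ha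
          obtain ⟨b, ⟨-, hb⟩, hab⟩ := ha
          exact hb a haπ hab
      have e₅ := card_le_card e₂
      have e₆ := card_compl_add_card B
      have e₇ : #A.toRight ≤ Fintype.card β := card_le_univ _
      rw [hA, hA', e₁, hcardZ]
      have := Nat.mul_le_mul_left (k + 1) e₄
      rw [mul_add] at this
      omega
    · rw [not_nonempty_iff_eq_empty] at hR
      rw [hR, card_empty, add_zero] at hA
      by_cases hlast : ∃ z ∈ A.toLeft, z.2 = Fin.last k
      · obtain ⟨z, hz, hzk⟩ := hlast
        have e₁ : (A.biUnion t).toRight = univ := by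
          ext z'
          simp only [mem_toRight, mem_biUnion, mem_univ, iff_true]
          exact ⟨_, mem_toLeft.1 hz, (ht₂ _ _).2 hzk⟩
        rw [hA, hA', e₁]
        omega
      · push Not at hlast
        have e₁ : #A.toLeft ≤ k * #π := by
          have : A.toLeft ⊆ π ×ˢ (univ.erase (Fin.last k) : Finset (Fin (k + 1))) := by
            intro z hz
            simp only [mem_product, mem_erase, mem_univ, and_true]
            exact ⟨mem_image_of_mem _ hz, hlast z hz⟩
          simpa [mul_comm] using card_le_card this
        have e₂ : (univ.filter fun b => ∃ a ∈ π, r a b) ⊆ (A.biUnion t).toLeft := by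
          intro b hb
          simp only [mem_filter, mem_univ, true_and] at hb
          obtain ⟨a, ha, hab⟩ := hb
          obtain ⟨z, hz, rfl⟩ := mem_image.1 ha
          simp only [mem_toLeft, mem_biUnion]
          exact ⟨_, mem_toLeft.1 hz, (ht₁ _ _).2 hab⟩
        have := card_le_card e₂
        have := h₁ π
        omega
  obtain ⟨φ, hφ, hφt⟩ := (all_card_le_biUnion_card_iff_exists_injective t).1 hall
  have hbij : Function.Bijective φ :=
    (Fintype.bijective_iff_injective_and_card φ).2 ⟨hφ, by simp [add_comm]⟩
  choose ψ hψ using hbij.2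
  have hψ' : ∀ x, ψ (φ x) = x := fun x => hφ (hψ (φ x))
  let w : β → Option α := fun b => match ψ (.inl b) with
    | .inl z => some z.1
    | .inr _ => none
  have hw : ∀ b a, w b = some a ↔ ∃ i, φ (.inl (a, i)) = .inl b := by
    intro b a
    constructor
    · intro h
      simp only [w] at h
      split at h
      · rename_i z hz
        cases h
        exact ⟨z.2, by rw [← hψ (.inl b), hz]⟩
      · cases h
    · rintro ⟨i, hi⟩
      simp only [w, ← hi, hψ']
  refine ⟨w, ?_, ?_, ?_⟩
  · intro b a h
    obtain ⟨i, hi⟩ := (hw b a).1 h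
    have := hφt (.inl (a, i))
    rw [hi] at this
    exact (ht₁ _ _).1 this
  · intro b hb h
    simp only [w] at h
    split at h
    · cases h
    · rename_i b' hb'
      have := hφt (.inr b')
      rw [← hb', hψ, hb', ht₃ b'] at this
      exact this hb
  · intro a
    have hle : #{b | w b = some a} ≤ k + 1 := by
      have : ∀ b : {b // w b = some a}, ∃ i, φ (.inl (a, i)) = .inl b.1 :=
        fun b => (hw b.1 a).1 b.2
      choose i hi using this
      have hinj : Function.Injective i := by
        intro b b' hbb
        have := hi b
        rw [hbb, hi b'] at this
        exact Subtype.ext (Sum.inl.inj this).symm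
      simpa [Fintype.card_subtype] using Fintype.card_le_of_injective i hinj
    have hge : k ≤ #{b | w b = some a} := by
      have : ∀ i : Fin k, ∃ b, φ (.inl (a, i.castSucc)) = .inl b := by
        intro i
        cases hx : φ (.inl (a, i.castSucc)) with
        | inl b => exact ⟨b, rfl⟩
        | inr z =>
          have := hφt (.inl (a, i.castSucc))
          rw [hx, ht₂] at this
          exact absurd this (Fin.castSucc_lt_last i).ne
      choose b hb using this
      have hinj : Function.Injective b := by
        intro i j hij
        have := hb i
        rw [hij, ← hb j] at this
        simpa using hφ this
      rw [← Fintype.card_fin k, ← card_univ]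
      exact card_le_card_of_injOn b (fun i _ => by simpa using (hw _ _).2 ⟨_, hb i⟩)
        hinj.injOn
    omega

theorem IsOddFamily.odd_card {V : Type*} {G : SimpleGraph V} {S : Finset V}
    {𝒟 : Finset (Finset V)} (h : IsOddFamily G (fun _ => 1) S 𝒟) {D : Finset V} (hD : D ∈ 𝒟) :
    Odd #D := by
  simpa using h.odd D hD

theorem IsOddFamily.union {V : Type*} [Fintype V] [DecidableEq V] {G : SimpleGraph V}
    {S T W : Finset V} {𝒜 ℬ : Finset (Finset V)} (h𝒜 : IsOddFamily G (fun _ => 1) S 𝒜)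
    (hℬ : IsOddFamily G (fun _ => 1) (T ∪ Wᶜ) ℬ) (hTW : T ⊆ W) (hWS : ∀ x ∈ W, x ∉ S)
    (hW𝒜 : ∀ x ∈ W, ∀ D ∈ 𝒜, x ∉ D) (hW : ∀ x ∈ W, ∀ y, G.Adj x y → y ∈ S ∨ y ∈ W) :
    IsOddFamily G (fun _ => 1) (S ∪ T) (𝒜 ∪ ℬ) ∧ #(𝒜 ∪ ℬ) = #𝒜 + #ℬ := by
  have hℬW : ∀ D ∈ ℬ, ∀ x ∈ D, x ∈ W := by
    intro D hD x hx
    have := hℬ.avoid D hD x hx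
    simp only [mem_union, mem_compl, not_or, not_not] at this
    exact this.2
  refine ⟨⟨?_, ?_, ?_, ?_⟩, card_union_of_disjoint ?_⟩
  · intro D hD E hE x hxD hxE
    rw [mem_union] at hD hE
    rcases hD with hD | hD <;> rcases hE with hE | hE
    · exact h𝒜.disj D hD E hE x hxD hxE
    · exact absurd hxD (hW𝒜 x (hℬW E hE x hxE) D hD)
    · exact absurd hxE (hW𝒜 x (hℬW D hD x hxD) E hE)
    · exact hℬ.disj D hD E hE x hxD hxE
  · intro D hD x hx
    rw [mem_union] at hD
    rw [mem_union, not_or]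
    rcases hD with hD | hD
    · exact ⟨h𝒜.avoid D hD x hx, fun hxT => hW𝒜 x (hTW hxT) D hD hx⟩
    · refine ⟨hWS x (hℬW D hD x hx), fun hxT => hℬ.avoid D hD x hx (mem_union_left _ hxT)⟩
  · intro D hD x hx y hxy
    rw [mem_union] at hD
    rw [mem_union]
    rcases hD with hD | hD
    · rcases h𝒜.closed D hD x hx y hxy with h | h
      · exact Or.inl (Or.inl h)
      · exact Or.inr h
    · rcases hW x (hℬW D hD x hx) y hxy with h | h
      · exact Or.inl (Or.inl h)
      · rcases hℬ.closed D hD x hx y hxy with h' | h'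
        · rw [mem_union, mem_compl] at h'
          exact Or.inl (Or.inr (h'.resolve_right fun h' => h' h))
        · exact Or.inr h'
  · intro D hD
    rw [mem_union] at hD
    rcases hD with hD | hD
    · exact h𝒜.odd D hD
    · exact hℬ.odd D hD
  · rw [Finset.disjoint_left]
    intro D hD hD'
    obtain ⟨x, hx⟩ := card_pos.1 (hℬ.odd_card hD').pos
    exact hW𝒜 x (hℬW D hD' x hx) D hD hx

/-- An odd family maximizing `#𝒟 - m * #S`, then `#S`, and then minimizing the total size. -/
structure IsOptimalFamily {V : Type*} (G : SimpleGraph V) (m : ℕ) (S : Finset V)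
    (𝒟 : Finset (Finset V)) : Prop where
  fam : IsOddFamily G (fun _ => 1) S 𝒟
  le : ∀ S' 𝒟', IsOddFamily G (fun _ => 1) S' 𝒟' → #𝒟' + m * #S ≤ #𝒟 + m * #S'
  card_le : ∀ S' 𝒟', IsOddFamily G (fun _ => 1) S' 𝒟' → #𝒟' + m * #S = #𝒟 + m * #S' → #S' ≤ #S
  sum_le : ∀ 𝒟', IsOddFamily G (fun _ => 1) S 𝒟' → #𝒟' = #𝒟 → ∑ D ∈ 𝒟, #D ≤ ∑ D ∈ 𝒟', #D

theorem exists_isOptimalFamily {V : Type*} [Fintype V] [DecidableEq V] (G : SimpleGraph V)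
    (m : ℕ) : ∃ S 𝒟, IsOptimalFamily G m S 𝒟 := by
  classical
  let key : Finset V × Finset (Finset V) → ℤ ×ₗ ℤ ×ₗ ℤ := fun p =>
    toLex ((#p.2 : ℤ) - m * #p.1, toLex ((#p.1 : ℤ), -((∑ D ∈ p.2, #D : ℕ) : ℤ)))
  obtain ⟨⟨S, 𝒟⟩, h, hmax⟩ := exists_max_image
    (univ.filter fun p : Finset V × Finset (Finset V) => IsOddFamily G (fun _ => 1) p.1 p.2) key
    ⟨(∅, ∅), by simp; constructor <;> simp⟩
  simp only [mem_filter, mem_univ, true_and, Prod.forall] at h hmax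
  simp only [key, Prod.Lex.toLex_le_toLex] at hmax
  refine ⟨S, 𝒟, h, fun S' 𝒟' h' => ?_, fun S' 𝒟' h' e => ?_, fun 𝒟' h' e => ?_⟩
  · zify
    rcases hmax S' 𝒟' h' with h | h
    · linarith
    · linarith [h.1]
  · zify at e ⊢
    rcases hmax S' 𝒟' h' with h | ⟨-, h | h⟩
    · linarith
    · linarith
    · linarith [h.1]
  · rcases hmax S 𝒟' h' with h | ⟨-, h | h⟩
    · rw [e] at h; exact absurd h (lt_irrefl _)
    · exact absurd h (lt_irrefl _)
    · have := h.2
      omega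

namespace IsOptimalFamily

variable {V : Type*} [Fintype V] [DecidableEq V] {G : SimpleGraph V} {m : ℕ} {S : Finset V}
  {𝒟 : Finset (Finset V)}

theorem union_erase (h : IsOptimalFamily G m S 𝒟) {C : Finset V} (hC : C ∈ 𝒟) {T : Finset V}
    (hT : T ⊆ C) {ℬ : Finset (Finset V)} (hℬ : IsOddFamily G (fun _ => 1) (T ∪ Cᶜ) ℬ) :
    IsOddFamily G (fun _ => 1) (S ∪ T) (𝒟.erase C ∪ ℬ) ∧
      #(𝒟.erase C ∪ ℬ) = #(𝒟.erase C) + #ℬ := by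
  refine IsOddFamily.union ⟨?_, ?_, ?_, ?_⟩ hℬ hT (h.fam.avoid C hC) ?_ (h.fam.closed C hC)
  · intro D hD E hE
    exact h.fam.disj D (mem_of_mem_erase hD) E (mem_of_mem_erase hE)
  · intro D hD
    exact h.fam.avoid D (mem_of_mem_erase hD)
  · intro D hD
    exact h.fam.closed D (mem_of_mem_erase hD)
  · intro D hD
    exact h.fam.odd D (mem_of_mem_erase hD)
  · intro x hx D hD hxD
    exact ne_of_mem_erase hD (h.fam.disj D (mem_of_mem_erase hD) C hC x hxD hx)

theorem card_family_le (h : IsOptimalFamily G m S 𝒟) {C : Finset V} (hC : C ∈ 𝒟) {T : Finset V}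
    (hT : T ⊆ C) (hTne : T.Nonempty) {ℬ : Finset (Finset V)}
    (hℬ : IsOddFamily G (fun _ => 1) (T ∪ Cᶜ) ℬ) : #ℬ ≤ m * #T := by
  obtain ⟨hu, hcard⟩ := h.union_erase hC hT hℬ
  have hST : #(S ∪ T) = #S + #T := by
    refine card_union_of_disjoint (Finset.disjoint_left.2 fun x hx hxT => ?_)
    exact h.fam.avoid C hC x (hT hxT) hx
  have h1 := h.le _ _ hu
  have h2 := h.card_le _ _ hu
  have h3 := card_erase_add_one hC
  have h4 := hTne.card_pos
  rw [hcard, hST, mul_add] at h1 h2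
  by_contra hcon
  have := h2 (by omega)
  omega

theorem card_family_lt (h : IsOptimalFamily G m S 𝒟) (hm : Odd m) {C : Finset V} (hC : C ∈ 𝒟)
    {T : Finset V} (hT : T ⊆ C) (hTne : T.Nonempty) {ℬ : Finset (Finset V)}
    (hℬ : IsOddFamily G (fun _ => 1) (T ∪ Cᶜ) ℬ) : #ℬ < m * #T := by
  refine lt_of_le_of_ne (h.card_family_le hC hT hTne hℬ) fun heq => ?_
  have hℬC : ∀ D ∈ ℬ, ∀ x ∈ D, x ∈ C ∧ x ∉ T := by
    intro D hD x hx
    have := hℬ.avoid D hD x hx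
    simp only [mem_union, mem_compl, not_or, not_not] at this
    exact this.symm
  set R := C \ (T ∪ ℬ.biUnion id) with hR
  have hRmem : ∀ x, x ∈ R ↔ x ∈ C ∧ x ∉ T ∧ ∀ D ∈ ℬ, x ∉ D := by
    intro x; simp [hR]
  have hsub : T ∪ ℬ.biUnion id ⊆ C := by
    refine union_subset hT (biUnion_subset.2 fun D hD x hx => (hℬC D hD x hx).1)
  have hcardR : #R + (#T + ∑ D ∈ ℬ, #D) = #C := by
    rw [← card_sdiff_add_card_eq_card hsub, card_union_of_disjoint, card_biUnion]
    · rfl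
    · intro D hD E hE hne
      exact Finset.disjoint_left.2 fun x hx hx' => hne (hℬ.disj D hD E hE x hx hx')
    · rw [Finset.disjoint_left]
      intro x hx hx'
      obtain ⟨D, hD, hxD⟩ := mem_biUnion.1 hx'
      exact (hℬC D hD x hxD).2 hx
  have hpar : (∑ D ∈ ℬ, #D) % 2 = #T % 2 := by
    have h1 := odd_sum_iff_odd_card_odd (s := ℬ) (fun D => #D)
    rw [filter_true_of_mem fun D hD => hℬ.odd_card hD, heq, Nat.odd_mul] at h1
    grind
  have hRodd : Odd #R := by
    have := h.fam.odd_card hC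
    grind
  have hRℬ : R ∉ ℬ := by
    intro hmem
    obtain ⟨x, hx⟩ := card_pos.1 hRodd.pos
    exact ((hRmem x).1 hx).2.2 R hmem hx
  have hfam : IsOddFamily G (fun _ => 1) (T ∪ Cᶜ) (insert R ℬ) := by
    refine ⟨?_, ?_, ?_, ?_⟩
    · intro D hD E hE x hxD hxE
      rw [mem_insert] at hD hE
      rcases hD with rfl | hD <;> rcases hE with rfl | hE
      · rfl
      · exact absurd hxE (((hRmem x).1 hxD).2.2 E hE)
      · exact absurd hxD (((hRmem x).1 hxE).2.2 D hD)
      · exact hℬ.disj D hD E hE x hxD hxE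
    · intro D hD x hx
      rcases mem_insert.1 hD with rfl | hD
      · have := (hRmem x).1 hx
        simp [this.1, this.2.1]
      · exact hℬ.avoid D hD x hx
    · intro D hD x hx y hxy
      rcases mem_insert.1 hD with rfl | hD
      · by_contra hcon
        simp only [mem_union, mem_compl, not_or, not_not, hRmem, not_and, not_forall] at hcon
        obtain ⟨⟨hyT, hyC⟩, hy⟩ := hcon
        obtain ⟨E, hE, hyE⟩ := hy hyC hyT
        have hx' := (hRmem x).1 hx
        rcases hℬ.closed E hE y hyE x hxy.symm with h' | h'
        · simp [hx'.1, hx'.2.1] at h'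
        · exact hx'.2.2 E hE h'
      · exact hℬ.closed D hD x hx y hxy
    · intro D hD
      rcases mem_insert.1 hD with rfl | hD
      · simpa using hRodd
      · exact hℬ.odd D hD
  have := h.card_family_le hC hT hTne hfam
  rw [card_insert_of_notMem hRℬ] at this
  omega

theorem eq_of_closed_of_odd (h : IsOptimalFamily G m S 𝒟) {C : Finset V} (hC : C ∈ 𝒟)
    {D : Finset V} (hDC : D ⊆ C) (hD : ∀ x ∈ D, ∀ y ∈ C, G.Adj x y → y ∈ D) (hodd : Odd #D) :
    D = C := by
  have hfam : IsOddFamily G (fun _ => 1) (∅ ∪ Cᶜ) {D} := by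
    refine ⟨?_, ?_, ?_, ?_⟩
    · simp
    · intro E hE x hx
      rw [mem_singleton.1 hE] at hx
      simpa using hDC hx
    · intro E hE x hx y hxy
      rw [mem_singleton.1 hE] at hx ⊢
      by_cases hy : y ∈ C
      · exact Or.inr (hD x hx y hy hxy)
      · left; simpa using hy
    · simpa using hodd
  obtain ⟨hu, hcard⟩ := h.union_erase hC (empty_subset _) hfam
  rw [union_empty] at hu
  have h1 := h.sum_le _ hu (by rw [hcard, card_singleton, card_erase_add_one hC])
  have hdisj : Disjoint (𝒟.erase C) {D} := card_union_eq_card_add_card.1 hcard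
  rw [sum_union hdisj, sum_singleton, ← sum_erase_add _ _ hC] at h1
  exact eq_of_subset_of_card_le hDC (by omega)

theorem exists_subgraph_of_mem (h : IsOptimalFamily G m S 𝒟) (hm : Odd m) {C : Finset V}
    (hC : C ∈ 𝒟) {x : V} (hx : x ∈ C) :
    ∃ F ≤ G, (∀ u v, F.Adj u v → u ∈ C) ∧
      ∀ v ∈ C, (F.neighborSet v).ncard + (if v = x then 1 else 0) ≤ m ∧
        Odd ((F.neighborSet v).ncard + (if v = x then 1 else 0)) := by
  set f : V → ℕ := fun v => m - if v = x then 1 else 0 with hf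
  have hfx : ∀ v, f v + (if v = x then 1 else 0) = m := by
    intro v
    have := hm.pos
    simp only [hf]
    split_ifs <;> omega
  have hsum : ∀ D : Finset V, ∑ v ∈ D, f v + (if x ∈ D then 1 else 0) = m * #D := by
    intro D
    have : (if x ∈ D then 1 else 0) = ∑ v ∈ D, if v = x then 1 else 0 := by simp
    rw [this, ← sum_add_distrib, sum_congr rfl fun v _ => hfx v]
    simp [mul_comm]
  obtain ⟨F, hF, hsupp, hdeg⟩ := exists_parity_subgraph_on G f C fun T hT ℬ hℬ => by
    have hℬC : ∀ D ∈ ℬ, D ⊆ C := by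
      intro D hD y hy
      have := hℬ.avoid D hD y hy
      simp only [mem_union, mem_compl, not_or, not_not] at this
      exact this.2
    rcases T.eq_empty_or_nonempty with rfl | hTne
    · rw [sum_empty, Nat.le_zero, card_eq_zero, eq_empty_iff_forall_notMem]
      intro D hD
      have hDodd := hℬ.odd D hD
      have hDs := hsum D
      have hDcl : ∀ u ∈ D, ∀ v ∈ C, G.Adj u v → v ∈ D := by
        intro u hu v hv huv
        refine (hℬ.closed D hD u hu v huv).resolve_left ?_
        simpa using hv
      have hCodd := h.fam.odd_card hC
      have hmD := Nat.odd_mul (m := m) (n := #D)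
      by_cases hxD : x ∈ D
      · rw [if_pos hxD] at hDs
        have hDeven : ¬ Odd #D := by grind
        have hcard := card_sdiff_add_card_eq_card (hℬC D hD)
        have := h.eq_of_closed_of_odd hC (D := C \ D) sdiff_subset (by
          intro u hu v hv huv
          rw [mem_sdiff] at hu ⊢
          exact ⟨hv, fun hvD => hu.2 (hDcl v hvD u hu.1 huv.symm)⟩) (by grind)
        rw [← this] at hx
        exact (mem_sdiff.1 hx).2 hxD
      · rw [if_neg hxD] at hDs
        have := h.eq_of_closed_of_odd hC (hℬC D hD) hDcl (by grind)
        exact hxD (this ▸ hx)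
    · have hfam : IsOddFamily G (fun _ => 1) (T ∪ Cᶜ) (ℬ.filter fun D => x ∉ D) := by
        refine ⟨fun D hD E hE => hℬ.disj D (mem_filter.1 hD).1 E (mem_filter.1 hE).1,
          fun D hD => hℬ.avoid D (mem_filter.1 hD).1, fun D hD => hℬ.closed D (mem_filter.1 hD).1,
          fun D hD => ?_⟩
        have h1 := hℬ.odd D (mem_filter.1 hD).1
        have h2 := hsum D
        rw [if_neg (mem_filter.1 hD).2, add_zero] at h2
        rw [h2, Nat.odd_mul] at h1
        simpa using h1.2
      have hlt := h.card_family_lt hm hC hT hTne hfam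
      have hsplit := card_filter_add_card_filter_not (s := ℬ) (fun D => x ∈ D)
      have hTs := hsum T
      by_cases hxT : x ∈ T
      · have : ℬ.filter (fun D => x ∈ D) = ∅ := by
          rw [filter_eq_empty_iff]
          exact fun D hD hxD => hℬ.avoid D hD x hxD (mem_union_left _ hxT)
        rw [this, card_empty] at hsplit
        rw [if_pos hxT] at hTs
        omega
      · have : #(ℬ.filter (fun D => x ∈ D)) ≤ 1 := by
          rw [card_le_one]
          intro D hD E hE
          rw [mem_filter] at hD hE
          exact hℬ.disj D hD.1 E hE.1 x hD.2 hE.2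
        rw [if_neg hxT] at hTs
        omega
  refine ⟨F, hF, hsupp, fun v hv => ?_⟩
  have h1 := hdeg v hv
  have h2 := hfx v
  grind

theorem exists_subgraph_rest (h : IsOptimalFamily G m S 𝒟) (hm : Odd m) {E : Finset V}
    (hE : ∀ v, v ∈ E ↔ v ∉ S ∧ ∀ D ∈ 𝒟, v ∉ D) :
    ∃ F ≤ G, (∀ u v, F.Adj u v → u ∈ E) ∧
      ∀ v ∈ E, (F.neighborSet v).ncard ≤ m ∧ Odd (F.neighborSet v).ncard := by
  obtain ⟨F, hF, hsupp, hdeg⟩ := exists_parity_subgraph_on G (fun _ => m) E fun T hT ℬ hℬ => by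
    have hfam : IsOddFamily G (fun _ => 1) (T ∪ Eᶜ) ℬ := by
      refine ⟨hℬ.disj, hℬ.avoid, hℬ.closed, fun D hD => ?_⟩
      have := hℬ.odd D hD
      rw [sum_const, smul_eq_mul, Nat.odd_mul] at this
      simpa using this.1
    obtain ⟨hu, hcard⟩ := h.fam.union hfam hT (fun x hx => ((hE x).1 hx).1)
      (fun x hx => ((hE x).1 hx).2) fun x hx y hxy => by
        by_contra hcon
        rw [hE] at hcon
        push Not at hcon
        obtain ⟨D, hD, hyD⟩ := hcon.2 hcon.1
        rcases h.fam.closed D hD y hyD x hxy.symm with h' | h'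
        · exact ((hE x).1 hx).1 h'
        · exact ((hE x).1 hx).2 D hD h'
    have h1 := h.le _ _ hu
    have hST : #(S ∪ T) = #S + #T := by
      refine card_union_of_disjoint (Finset.disjoint_left.2 fun x hx hxT => ?_)
      exact ((hE x).1 (hT hxT)).1 hx
    rw [hcard, hST, mul_add] at h1
    simp only [sum_const, smul_eq_mul]
    rw [mul_comm]
    omega
  refine ⟨F, hF, hsupp, fun v hv => ⟨(hdeg v hv).1, ?_⟩⟩
  have := (hdeg v hv).2
  grind

end IsOptimalFamily

theorem IsOptimalFamily.card_adj_ge {V : Type*} [DecidableEq V] {G : SimpleGraph V}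
    [DecidableRel G.Adj] {m : ℕ} {S : Finset V} {𝒟 : Finset (Finset V)}
    (h : IsOptimalFamily G m S 𝒟) {A : Finset V} (hA : A ⊆ S) :
    m * #A ≤ #{C ∈ 𝒟 | ∃ a ∈ A, ∃ x ∈ C, G.Adj a x} := by
  have hfam : IsOddFamily G (fun _ => 1) (S \ A)
      (𝒟.filter fun C => ¬ ∃ a ∈ A, ∃ x ∈ C, G.Adj a x) := by
    refine ⟨fun D hD E hE => h.fam.disj D (mem_filter.1 hD).1 E (mem_filter.1 hE).1,
      fun D hD x hx hxS => h.fam.avoid D (mem_filter.1 hD).1 x hx (mem_sdiff.1 hxS).1,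
      fun D hD x hx y hxy => ?_, fun D hD => h.fam.odd D (mem_filter.1 hD).1⟩
    rw [mem_filter] at hD
    rcases h.fam.closed D hD.1 x hx y hxy with h' | h'
    · exact Or.inl (mem_sdiff.2 ⟨h', fun hyA => hD.2 ⟨y, hyA, x, hx, hxy.symm⟩⟩)
    · exact Or.inr h'
  have h1 := h.le _ _ hfam
  have h2 := card_filter_add_card_filter_not (s := 𝒟) (fun C => ∃ a ∈ A, ∃ x ∈ C, G.Adj a x)
  have h3 := card_sdiff_add_card_eq_card hA
  rw [← h3, mul_add] at h1
  omega

/-- `d` is one of the admissible degrees `1, 3, …, 2n - 1, 2n`. -/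
def IsHnDegree (n d : ℕ) : Prop := (Odd d ∧ d ≤ 2 * n - 1) ∨ d = 2 * n

/-- The subgraph of `G` induced on `W` has an `Hₙ`-factor. -/
def HasHnFactorOn (n : ℕ) {V : Type*} (G : SimpleGraph V) (W : Finset V) : Prop :=
  ∃ F ≤ G, (∀ u v, F.Adj u v → u ∈ W) ∧ ∀ v ∈ W, IsHnDegree n (F.neighborSet v).ncard

theorem exists_barrier {V : Type*} [Fintype V] [DecidableEq V] {n : ℕ} (hn : 1 ≤ n)
    (G : SimpleGraph V)
    (heven : ∀ D : Finset V, (∀ x ∈ D, ∀ y, G.Adj x y → y ∈ D) → Even #D)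
    (hno : ¬ ∃ F, IsHnFactor n G F) :
    ∃ S 𝒩, S.Nonempty ∧ IsOddFamily G (fun _ => 1) S 𝒩 ∧ 2 * n * #S < #𝒩 ∧
      ∀ C ∈ 𝒩, ¬ HasHnFactorOn n G C := by
  classical
  obtain ⟨m, hm⟩ : ∃ m, 2 * n = m + 1 := ⟨2 * n - 1, by omega⟩
  have hmodd : Odd m := by grind
  obtain ⟨S, 𝒟, hopt⟩ := exists_isOptimalFamily G m
  by_contra hbar
  refine hno ?_
  obtain ⟨w, hwr, hwN, hwk⟩ := exists_assignment (α := S) (β := 𝒟)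
    (fun a b => ∃ x ∈ b.1, G.Adj a x) {b | ¬ HasHnFactorOn n G b.1} m
    (by
      intro A
      have h := hopt.card_adj_ge (A := A.map (Function.Embedding.subtype _)) (by
        intro a ha
        obtain ⟨a, -, rfl⟩ := mem_map.1 ha
        exact a.2)
      rw [card_map] at h
      refine h.trans (le_of_eq ?_)
      rw [← card_map (Function.Embedding.subtype (· ∈ 𝒟))]
      congr 1
      ext C
      simp [and_comm])
    (by
      intro B hB
      by_contra hcon
      refine hbar ⟨(univ.filter fun a : S => ∃ b ∈ B, ∃ x ∈ b.1, G.Adj a x).map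
        (Function.Embedding.subtype _), B.map (Function.Embedding.subtype _), ?_, ?_, ?_, ?_⟩
      · rw [map_nonempty, nonempty_iff_ne_empty]
        intro hemp
        have hpos : 0 < #B := by omega
        obtain ⟨b, hb⟩ := card_pos.1 hpos
        have hodd := hopt.fam.odd_card b.2
        refine (Nat.not_even_iff_odd.2 hodd) (heven _ fun x hx y hxy => ?_)
        refine (hopt.fam.closed _ b.2 x hx y hxy).resolve_left fun hy => ?_
        exact filter_eq_empty_iff.1 hemp (mem_univ ⟨y, hy⟩) ⟨b, hb, x, hx, hxy.symm⟩
      · have hmem : ∀ C ∈ B.map (Function.Embedding.subtype (· ∈ 𝒟)),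
            ∃ hC : C ∈ 𝒟, ⟨C, hC⟩ ∈ B := by
          intro C hC
          simpa using hC
        refine ⟨fun D hD E hE => hopt.fam.disj D (hmem D hD).1 E (hmem E hE).1,
          fun D hD x hx hxS => hopt.fam.avoid D (hmem D hD).1 x hx ?_,
          fun D hD x hx y hxy => ?_, fun D hD => hopt.fam.odd D (hmem D hD).1⟩
        · obtain ⟨a, -, rfl⟩ := mem_map.1 hxS
          exact a.2
        · refine (hopt.fam.closed D (hmem D hD).1 x hx y hxy).imp (fun hy => ?_) id
          exact mem_map.2 ⟨⟨y, hy⟩, mem_filter.2 ⟨mem_univ _, _, (hmem D hD).2, x, hx, hxy.symm⟩,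
            rfl⟩
      · rw [card_map, card_map, hm]
        omega
      · intro C hC
        obtain ⟨b, hb, rfl⟩ := mem_map.1 hC
        exact (mem_filter.1 (hB hb)).2)
  have hloc : ∀ b : 𝒟, ∃ (F : SimpleGraph V) (x : V), F ≤ G ∧ (∀ u v, F.Adj u v → u ∈ b.1) ∧
      x ∈ b.1 ∧ (∀ a, w b = some a → G.Adj a x) ∧ ∀ v ∈ b.1,
        IsHnDegree n ((F.neighborSet v).ncard + if (w b).isSome ∧ v = x then 1 else 0) := by
    intro b
    cases hb : w b with
    | none =>
      have : HasHnFactorOn n G b.1 := by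
        by_contra hcon
        exact hwN b (by simpa using hcon) hb
      obtain ⟨F, hF, hsupp, hdeg⟩ := this
      obtain ⟨x, hx⟩ := card_pos.1 (hopt.fam.odd_card b.2).pos
      exact ⟨F, x, hF, hsupp, hx, by simp, by simpa using hdeg⟩
    | some a =>
      obtain ⟨x, hx, hax⟩ := hwr b a hb
      obtain ⟨F, hF, hsupp, hdeg⟩ := hopt.exists_subgraph_of_mem hmodd b.2 hx
      refine ⟨F, x, hF, hsupp, hx, by simpa using hax, fun v hv => Or.inl ?_⟩
      obtain ⟨h1, h2⟩ := hdeg v hv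
      simp only [Option.isSome_some, true_and]
      exact ⟨h2, by omega⟩
  choose Fb x hFb hFbs hxb hxadj hFbdeg using hloc
  obtain ⟨FE, hFE, hFEs, hFEdeg⟩ := hopt.exists_subgraph_rest hmodd
    (E := univ.filter fun v => v ∉ S ∧ ∀ D ∈ 𝒟, v ∉ D) (by simp)
  simp only [mem_filter, mem_univ, true_and] at hFEs hFEdeg
  have hbS : ∀ (b : 𝒟), ∀ v ∈ b.1, v ∉ S := fun b => hopt.fam.avoid b.1 b.2
  have hbb : ∀ (b b' : 𝒟) (v : V), v ∈ b.1 → v ∈ b'.1 → b' = b := fun b b' v hv hv' =>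
    Subtype.ext (hopt.fam.disj _ b'.2 _ b.2 v hv' hv)
  let F : SimpleGraph V :=
    { Adj := fun u v => (∃ b, (Fb b).Adj u v) ∨ FE.Adj u v ∨
        ∃ b a, w b = some a ∧ (u = a ∧ v = x b ∨ v = a ∧ u = x b)
      symm := ⟨by
        rintro u v (⟨b, h⟩ | h | ⟨b, a, h, h'⟩)
        · exact Or.inl ⟨b, h.symm⟩
        · exact Or.inr (Or.inl h.symm)
        · exact Or.inr (Or.inr ⟨b, a, h, h'.symm⟩)⟩
      loopless := ⟨by
        rintro u (⟨b, h⟩ | h | ⟨b, a, h, ⟨h', h''⟩ | ⟨h', h''⟩⟩)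
        · exact h.ne rfl
        · exact h.ne rfl
        · exact hbS b u (h'' ▸ hxb b) (h' ▸ a.2)
        · exact hbS b u (h'' ▸ hxb b) (h' ▸ a.2)⟩ }
  have hF : ∀ u v, F.Adj u v ↔ (∃ b, (Fb b).Adj u v) ∨ FE.Adj u v ∨
        ∃ b a, w b = some a ∧ (u = a ∧ v = x b ∨ v = a ∧ u = x b) := fun u v => Iff.rfl
  refine ⟨F, ?_, fun v => ?_⟩
  · rintro u v (⟨b, h⟩ | h | ⟨b, a, h, ⟨rfl, rfl⟩ | ⟨rfl, rfl⟩⟩)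
    · exact hFb b h
    · exact hFE h
    · exact hxadj b a h
    · exact (hxadj b a h).symm
  · by_cases hvS : v ∈ S
    · have hN : F.neighborSet v = x '' {b | w b = some ⟨v, hvS⟩} := by
        ext u
        simp only [mem_neighborSet, hF, Set.mem_image]
        constructor
        · rintro (⟨b, h⟩ | h | ⟨b, a, h, ⟨rfl, rfl⟩ | ⟨rfl, rfl⟩⟩)
          · exact absurd hvS (hbS b v (hFbs b _ _ h))
          · exact absurd hvS (hFEs _ _ h).1
          · exact ⟨b, h, rfl⟩
          · exact absurd hvS (hbS b _ (hxb b))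
        · rintro ⟨b, h, rfl⟩
          exact Or.inr (Or.inr ⟨b, _, h, Or.inl ⟨rfl, rfl⟩⟩)
      have hxinj : Function.Injective x := fun b b' h => hbb b' b (x b') (hxb b') (h ▸ hxb b)
      have hc : (F.neighborSet v).ncard = #{b | w b = some ⟨v, hvS⟩} := by
        rw [hN, Set.ncard_image_of_injective _ hxinj, ← Set.ncard_coe_finset]
        congr 1
        ext b
        simp
      rw [hc]
      rcases hwk ⟨v, hvS⟩ with h | h <;> rw [h]
      · exact Or.inl ⟨hmodd, by omega⟩
      · exact Or.inr hm.symm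
    · by_cases hv : ∃ b : 𝒟, v ∈ b.1
      · obtain ⟨b, hvb⟩ := hv
        have hN : F.neighborSet v =
            (Fb b).neighborSet v ∪ {u | ∃ a, w b = some a ∧ v = x b ∧ u = a} := by
          ext u
          simp only [mem_neighborSet, hF, Set.mem_union, Set.mem_ofPred_eq]
          constructor
          · rintro (⟨b', h⟩ | h | ⟨b', a, h, ⟨h', h''⟩ | ⟨h', h''⟩⟩)
            · rw [hbb b b' v hvb (hFbs b' _ _ h)] at h
              exact Or.inl h
            · exact absurd hvb ((hFEs _ _ h).2 b.1 b.2)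
            · exact absurd (h' ▸ a.2) hvS
            · have := hbb b b' v hvb (h'' ▸ hxb b')
              subst this
              exact Or.inr ⟨a, h, h'', h'⟩
          · rintro (h | ⟨a, h, h', h''⟩)
            · exact Or.inl ⟨b, h⟩
            · exact Or.inr (Or.inr ⟨b, a, h, Or.inr ⟨h'', h'⟩⟩)
        have hc : (F.neighborSet v).ncard =
            ((Fb b).neighborSet v).ncard + if (w b).isSome ∧ v = x b then 1 else 0 := by
          rw [hN]
          split_ifs with hif
          · obtain ⟨a, ha⟩ := Option.isSome_iff_exists.1 hif.1
            have : {u : V | ∃ a, w b = some a ∧ v = x b ∧ u = a} = {(a : V)} := by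
              ext u
              simp only [Set.mem_ofPred_eq, Set.mem_singleton_iff, ha, hif.2, true_and,
                Option.some.injEq, exists_eq_left']
            rw [this, Set.union_singleton, Set.ncard_insert_of_notMem _ (Set.toFinite _)]
            intro hmem
            exact hbS b a (hFbs b _ _ (Adj.symm hmem)) a.2
          · have : {u : V | ∃ a, w b = some a ∧ v = x b ∧ u = a} = ∅ := by
              ext u
              simp only [Set.mem_ofPred_eq, Set.mem_empty_iff_false, iff_false]
              rintro ⟨a, ha, hv, -⟩
              exact hif ⟨by simp [ha], hv⟩
            rw [this, Set.union_empty, add_zero]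
        rw [hc]
        exact hFbdeg b v hvb
      · have hvE : v ∉ S ∧ ∀ D ∈ 𝒟, v ∉ D := ⟨hvS, fun D hD h => hv ⟨⟨D, hD⟩, h⟩⟩
        have hN : F.neighborSet v = FE.neighborSet v := by
          ext u
          simp only [mem_neighborSet, hF]
          constructor
          · rintro (⟨b', h⟩ | h | ⟨b', a, h, ⟨h', h''⟩ | ⟨h', h''⟩⟩)
            · exact absurd ⟨b', hFbs b' _ _ h⟩ hv
            · exact h
            · exact absurd (h' ▸ a.2) hvS
            · exact absurd ⟨b', h'' ▸ hxb b'⟩ hv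
          · exact fun h => Or.inr (Or.inl h)
        rw [hN]
        obtain ⟨h1, h2⟩ := hFEdeg v hvE
        exact Or.inl ⟨h2, by omega⟩

theorem hasHnFactorOn_of_isClique {V : Type*} [Fintype V] [DecidableEq V] {n : ℕ} (hn : 1 ≤ n)
    (G : SimpleGraph V) {C : Finset V} (hC : ∀ u ∈ C, ∀ v ∈ C, u ≠ v → G.Adj u v)
    (hodd : Odd #C) (hcard : 2 * n + 1 ≤ #C) : HasHnFactorOn n G C := by
  obtain ⟨x, hx⟩ := card_pos.1 hodd.pos
  obtain ⟨L, hL, hLcard⟩ := exists_subset_card_eq (s := C.erase x) (n := 2 * n)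
    (by rw [card_erase_of_mem hx]; omega)
  have hxL : x ∉ L := fun h => notMem_erase x C (hL h)
  have hLC : ∀ v ∈ L, v ∈ C := fun v hv => mem_of_mem_erase (hL hv)
  set R := C \ insert x L with hR
  have hRmem : ∀ v, v ∈ R ↔ v ∈ C ∧ v ≠ x ∧ v ∉ L := by
    intro v; simp [hR]
  have hReven : Even #R := by
    have h1 := card_sdiff_add_card_eq_card (insert_subset hx (hL.trans (erase_subset _ _)))
    rw [card_insert_of_notMem hxL] at h1
    grind
  obtain ⟨M, hM, hMs, hMdeg⟩ := exists_parity_subgraph_on G (fun _ => 1) R fun T hT ℬ hℬ => by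
    have hℬR : ∀ D ∈ ℬ, D ⊆ R := by
      intro D hD y hy
      have := hℬ.avoid D hD y hy
      simp only [mem_union, mem_compl, not_or, not_not] at this
      exact this.2
    rcases T.eq_empty_or_nonempty with rfl | hTne
    · rw [sum_empty, Nat.le_zero, card_eq_zero, eq_empty_iff_forall_notMem]
      intro D hD
      have hDodd := hℬ.odd_card hD
      obtain ⟨y, hy⟩ := card_pos.1 hDodd.pos
      have : D = R := (hℬR D hD).antisymm fun z hz => by
        by_cases hzy : y = z
        · exact hzy ▸ hy
        refine (hℬ.closed D hD y hy z (hC y ((hRmem y).1 (hℬR D hD hy)).1 z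
          ((hRmem z).1 hz).1 hzy)).resolve_left ?_
        simpa using hz
      exact Nat.not_even_iff_odd.2 hDodd (this ▸ hReven)
    · refine le_trans (card_le_one.2 fun D hD E hE => ?_)
        (by simpa using hTne.card_pos)
      obtain ⟨y, hy⟩ := card_pos.1 (hℬ.odd_card hD).pos
      obtain ⟨z, hz⟩ := card_pos.1 (hℬ.odd_card hE).pos
      by_cases hyz : y = z
      · exact hℬ.disj D hD E hE y hy (hyz ▸ hz)
      refine hℬ.disj D hD E hE z ((hℬ.closed D hD y hy z (hC y ((hRmem y).1 (hℬR D hD hy)).1 z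
        ((hRmem z).1 (hℬR E hE hz)).1 hyz)).resolve_left (hℬ.avoid E hE z hz)) hz
  let F : SimpleGraph V :=
    { Adj := fun u v => M.Adj u v ∨ (u = x ∧ v ∈ L ∨ v = x ∧ u ∈ L)
      symm := ⟨fun u v h => h.imp (fun h => h.symm) Or.symm⟩
      loopless := ⟨by
        rintro u (h | ⟨rfl, h⟩ | ⟨rfl, h⟩)
        · exact h.ne rfl
        · exact hxL h
        · exact hxL h⟩ }
  have hF : ∀ u v, F.Adj u v ↔ M.Adj u v ∨ (u = x ∧ v ∈ L ∨ v = x ∧ u ∈ L) :=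
    fun u v => Iff.rfl
  have hMR : ∀ u v, M.Adj u v → u ∈ C ∧ u ≠ x ∧ u ∉ L := fun u v h => (hRmem u).1 (hMs u v h)
  refine ⟨F, ?_, ?_, fun v hv => ?_⟩
  · rintro u v (h | ⟨rfl, h⟩ | ⟨rfl, h⟩)
    · exact hM h
    · exact hC u hx v (hLC v h) fun e => hxL (e ▸ h)
    · exact hC u (hLC u h) v hx fun e => hxL (e ▸ h)
  · rintro u v (h | ⟨rfl, h⟩ | ⟨rfl, h⟩)
    · exact (hMR u v h).1
    · exact hx
    · exact hLC u h
  · by_cases hvx : v = x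
    · subst hvx
      have hN : F.neighborSet v = L := by
        ext u
        simp only [mem_neighborSet, hF, mem_coe]
        constructor
        · rintro (h | h | ⟨rfl, h⟩)
          · exact absurd rfl (hMR _ _ h).2.1
          · exact h.2
          · exact h
        · exact fun h => Or.inr (Or.inl ⟨trivial, h⟩)
      rw [hN, Set.ncard_coe_finset, hLcard]
      exact Or.inr rfl
    by_cases hvL : v ∈ L
    · have hN : F.neighborSet v = {x} := by
        ext u
        simp only [mem_neighborSet, hF, Set.mem_singleton_iff]
        constructor
        · rintro (h | h | h)
          · exact absurd hvL (hMR _ _ h).2.2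
          · exact absurd h.1 hvx
          · exact h.1
        · exact fun h => Or.inr (Or.inr ⟨h, hvL⟩)
      rw [hN, Set.ncard_singleton]
      exact Or.inl ⟨odd_one, by omega⟩
    · have hN : F.neighborSet v = M.neighborSet v := by
        ext u
        simp only [mem_neighborSet, hF, hvx, hvL, false_and, and_false, or_false]
      obtain ⟨h1, h2⟩ := hMdeg v ((hRmem v).2 ⟨hv, hvx, hvL⟩)
      rw [hN]
      exact Or.inl ⟨by grind, by omega⟩

theorem even_card_of_closed {V : Type*} [Fintype V] (G : SimpleGraph V)
    (hno : ∀ c : G.ConnectedComponent, ¬ Odd (Nat.card c.supp)) (D : Finset V)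
    (hD : ∀ x ∈ D, ∀ y, G.Adj x y → y ∈ D) : Even #D := by
  classical
  have hreach : ∀ x y, G.Reachable x y → x ∈ D → y ∈ D := by
    rintro x y ⟨p⟩
    induction p with
    | nil => exact id
    | cons h _ ih => exact fun hx => ih (hD _ hx _ h)
  rw [card_eq_sum_card_image G.connectedComponentMk D]
  refine even_sum _ fun c hc => ?_
  obtain ⟨x, hx, rfl⟩ := mem_image.1 hc
  rw [← Nat.not_odd_iff_even]
  convert hno (G.connectedComponentMk x) using 2
  rw [Nat.card_coe_set_eq, ← Set.ncard_coe_finset]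
  congr 1
  ext y
  simp only [coe_filter, Set.mem_ofPred_eq, ConnectedComponent.mem_supp_iff, and_iff_right_iff_imp,
    ConnectedComponent.eq]
  exact fun h => hreach x y h.symm hx

theorem exists_two_smallest {V : Type*} [DecidableEq V] {𝒩 : Finset (Finset V)} (h : 2 ≤ #𝒩) :
    ∃ A ∈ 𝒩, ∃ B ∈ 𝒩, A ≠ B ∧ #A ≤ #B ∧ #A + (#𝒩 - 1) * #B ≤ ∑ D ∈ 𝒩, #D := by
  obtain ⟨A, hA, hAmin⟩ := exists_min_image 𝒩 card (card_pos.1 (by omega))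
  obtain ⟨B, hB, hBmin⟩ := exists_min_image (𝒩.erase A) card
    (card_pos.1 (by rw [card_erase_of_mem hA]; omega))
  refine ⟨A, hA, B, mem_of_mem_erase hB, (ne_of_mem_erase hB).symm,
    hAmin B (mem_of_mem_erase hB), ?_⟩
  rw [← add_sum_erase _ _ hA, ← card_erase_of_mem hA, ← smul_eq_mul]
  exact Nat.add_le_add_left (card_nsmul_le_sum _ _ _ hBmin) _

theorem IsOddFamily.card_add_sum_le {V : Type*} [Fintype V] [DecidableEq V] {G : SimpleGraph V}
    {f : V → ℕ} {S : Finset V} {𝒟 : Finset (Finset V)} (h : IsOddFamily G f S 𝒟) :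
    #S + ∑ D ∈ 𝒟, #D ≤ Fintype.card V := by
  have h1 : #(𝒟.biUnion id) = ∑ D ∈ 𝒟, #D := card_biUnion fun D hD E hE hne =>
    Finset.disjoint_left.2 fun x hx hx' => hne (h.disj D hD E hE x hx hx')
  rw [← h1, ← card_union_of_disjoint]
  · exact card_le_univ _
  · rw [Finset.disjoint_left]
    intro x hx hx'
    obtain ⟨D, hD, hxD⟩ := mem_biUnion.1 hx'
    exact h.avoid D hD x hxD hx

theorem IsOddFamily.ncard_union_le {V : Type*} [DecidableEq V] {G : SimpleGraph V}
    {f : V → ℕ} {S : Finset V} {𝒟 : Finset (Finset V)} (h : IsOddFamily G f S 𝒟)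
    {C D : Finset V} (hC : C ∈ 𝒟) (hD : D ∈ 𝒟) {u v : V} (hu : u ∈ C) (hv : v ∈ D) :
    (G.neighborSet u ∪ G.neighborSet v).ncard ≤ #(S ∪ (C.erase u ∪ D.erase v)) := by
  rw [← Set.ncard_coe_finset]
  refine Set.ncard_le_ncard (fun y hy => ?_) (finite_toSet _)
  simp only [mem_coe, mem_union, mem_erase]
  rcases hy with hy | hy
  · exact (h.closed C hC u hu y hy).imp_right fun h => Or.inl ⟨hy.ne', h⟩
  · exact (h.closed D hD v hv y hy).imp_right fun h => Or.inr ⟨hy.ne', h⟩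

theorem nat_bounds_of_gt_max {n g N : ℕ} (hn : 1 ≤ n)
    (h : (N : ℝ) > max (max (((g : ℝ) - 2) / (2 * n) - 1) ((2 * (g : ℝ) - 4) / (4 * n + 1)))
      (max (((g : ℝ) - 1) / (2 * n + 1)) (4 * (n : ℝ) - 3))) :
    g < 2 * n * (N + 1) + 2 ∧ 2 * g < (4 * n + 1) * N + 4 ∧ g < (2 * n + 1) * N + 1 ∧
      4 * n < N + 3 := by
  have hn' : (1 : ℝ) ≤ n := by exact_mod_cast hn
  rw [gt_iff_lt, max_lt_iff, max_lt_iff, max_lt_iff, sub_lt_iff_lt_add, div_lt_iff₀ (by positivity),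
    div_lt_iff₀ (by positivity), div_lt_iff₀ (by positivity)] at h
  obtain ⟨⟨h1, h2⟩, h3, h4⟩ := h
  refine ⟨?_, ?_, ?_, ?_⟩
  · rify; linarith
  · rify; linarith
  · rify; linarith
  · rify; linarith

end

theorem stmt_8 {V : Type*} [Fintype V] (n : ℕ) (hn : 1 ≤ n) (G : SimpleGraph V)
    (hno : ∀ c : G.ConnectedComponent, ¬ Odd (Nat.card c.supp))
    (h : ∀ u v : V, u ≠ v → ¬ G.Adj u v →
      ((G.neighborSet u ∪ G.neighborSet v).ncard : ℝ) >
        max (max (((Fintype.card V : ℝ) - 2) / (2 * n) - 1)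
              ((2 * (Fintype.card V : ℝ) - 4) / (4 * n + 1)))
            (max (((Fintype.card V : ℝ) - 1) / (2 * n + 1)) (4 * (n : ℝ) - 3))) :
    ∃ F, IsHnFactor n G F := by
  classical
  by_contra hF
  obtain ⟨S, 𝒩, hSne, hfam, hcard, hbad⟩ :=
    exists_barrier hn G (even_card_of_closed G hno) hF
  have hs := hSne.card_pos
  have hns : n ≤ n * S.card := Nat.le_mul_of_pos_right n hs
  obtain ⟨A, hA, B, hB, hAB, hle, hsum⟩ := exists_two_smallest (𝒩 := 𝒩) (by grind)
  have hg : S.card + A.card + 2 * n * S.card * B.card ≤ Fintype.card V := by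
    have h1 := hfam.card_add_sum_le
    have h2 : 2 * n * S.card * B.card ≤ (𝒩.card - 1) * B.card :=
      Nat.mul_le_mul_right _ (by omega)
    omega
  have hAodd := hfam.odd_card hA
  have hBodd := hfam.odd_card hB
  obtain ⟨u, hu⟩ := Finset.card_pos.1 hAodd.pos
  obtain ⟨v, hv⟩ := Finset.card_pos.1 hBodd.pos
  have huB : u ∉ B := fun huB => hAB (hfam.disj A hA B hB u hu huB)
  have huv : ¬ G.Adj u v := fun hadj =>
    (hfam.closed A hA u hu v hadj).elim (hfam.avoid B hB v hv)
      fun hvA => hAB (hfam.disj A hA B hB v hvA hv)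
  obtain ⟨h1, h2, h3, h4⟩ := nat_bounds_of_gt_max hn (h u v (fun e => huB (e ▸ hv)) huv)
  have hN : (G.neighborSet u ∪ G.neighborSet v).ncard + 2 ≤ S.card + A.card + B.card := by
    have h5 := hfam.ncard_union_le hA hB hu hv
    have h6 := Finset.card_union_le S (A.erase u ∪ B.erase v)
    have h7 := Finset.card_union_le (A.erase u) (B.erase v)
    have h8 := Finset.card_erase_add_one hu
    have h9 := Finset.card_erase_add_one hv
    omega
  generalize (G.neighborSet u ∪ G.neighborSet v).ncard = N at h1 h2 h3 h4 hN
  have hB3 : 3 ≤ B.card := by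
    by_contra hlt
    have hb : B.card = 1 := by grind
    have ha : A.card = 1 := by grind
    rw [ha, hb] at hN hg
    have : (2 * n + 1) * N ≤ (2 * n + 1) * S.card := Nat.mul_le_mul_left _ (by omega)
    rw [add_mul] at this
    grind
  rcases (show S.card = 1 ∨ 2 ≤ S.card by omega) with hs1 | hs2
  · refine hbad B hB (hasHnFactorOn_of_isClique hn G (fun x hx y hy hxy => ?_) hBodd ?_)
    · by_contra hadj
      have h5 := (nat_bounds_of_gt_max hn (h x y hxy hadj)).1
      have h6 : (G.neighborSet x ∪ G.neighborSet y).ncard ≤ (S ∪ (B.erase x).erase y).card := by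
        rw [← Set.ncard_coe_finset]
        refine Set.ncard_le_ncard (fun z hz => ?_) (Finset.finite_toSet _)
        simp only [Finset.mem_coe, Finset.mem_union, Finset.mem_erase]
        rcases hz with hz | hz
        · exact (hfam.closed B hB x hx z hz).imp_right fun h =>
            ⟨fun e => hadj (e ▸ hz), hz.ne', h⟩
        · exact (hfam.closed B hB y hy z hz).imp_right fun h =>
            ⟨hz.ne', fun e => hadj (Adj.symm (e ▸ hz)), h⟩
      have h7 := Finset.card_union_le S ((B.erase x).erase y)
      rw [Finset.card_erase_of_mem (Finset.mem_erase.2 ⟨hxy.symm, hy⟩),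
        Finset.card_erase_of_mem hx] at h7
      have h8 : 2 * n * ((G.neighborSet x ∪ G.neighborSet y).ncard + 1) ≤ 2 * n * B.card :=
        Nat.mul_le_mul_left _ (by omega)
      rw [hs1, mul_one] at hg
      have := hAodd.pos
      omega
    · grind
  · have h5 : 2 * n * (N + 1) ≤ 2 * n * (S.card + A.card + B.card - 1) :=
      Nat.mul_le_mul_left _ (by omega)
    have h6 : S.card * B.card < S.card + A.card + B.card - 1 := by
      have := hAodd.pos
      refine Nat.lt_of_mul_lt_mul_left (a := 2 * n) ?_
      rw [← mul_assoc]
      omega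
    have h7 : S.card = 2 := by
      by_contra hne
      obtain ⟨k, hk⟩ : ∃ k, S.card = k + 3 := ⟨S.card - 3, by omega⟩
      obtain ⟨b, hb⟩ : ∃ b, B.card = b + 3 := ⟨B.card - 3, by omega⟩
      rw [hk, hb] at h6
      have : (k + 3) * (b + 3) = k * b + 3 * k + 3 * b + 9 := by ring
      omega
    have h8 : A.card = B.card := by
      rw [h7] at h6
      omega
    rw [h7, h8] at hg hN
    have h9 : (4 * n + 1) * N ≤ (4 * n + 1) * (2 * B.card) := Nat.mul_le_mul_left _ (by omega)
    nlinarith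
end
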